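/- arXiv:1009.1939 — 2 statements merged into one kernel-verified Lean document; each statement's English description precedes it below -/
import Mathlib

section
/- In the partition algebra A_k(z) (k ≥ 2): for every i with 1 ≤ i ≤ k−1 the following hold: (1) (L_{i+1/2} + L_{i+1}) p_{i+1} = p_{i+1} (L_{i+1/2} + L_{i+1}) = z p_{i+1}; (2) (L_i + L_{i+1/2}) p_{i+1/2} = p_{i+1/2} (L_i + L_{i+1/2}) = z p_{i+1/2}; (3) (L_{i−1/2} + L_i + L_{i+1/2} + L_{i+1}) s_i = s_i (L_{i−1/2} + L_i + L_{i+1/2} + L_{i+1}). -/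
open Polynomial

/-- Elements of an algebra over `R = ℤ[z]` (with `z = Polynomial.X`) satisfying the
defining relations of the partition algebra `A_k(z)` of Halverson–Ram.
Here `p i` stands for the generator `p_i` (for `1 ≤ i ≤ k`), `q i` stands for the
half-integer generator `p_{i+1/2}` (for `1 ≤ i ≤ k-1`), and `s i` stands for `s_i`
(for `1 ≤ i ≤ k-1`). -/
structure PartitionAlgebra (k : ℕ) (A : Type*) [Ring A] [Algebra (Polynomial ℤ) A] where
  p : ℕ → A
  q : ℕ → A
  s : ℕ → A
  s_sq : ∀ i, 1 ≤ i → i ≤ k - 1 → s i * s i = 1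
  s_comm : ∀ i j, 1 ≤ i → i ≤ k - 1 → 1 ≤ j → j ≤ k - 1 → j ≠ i + 1 → i ≠ j + 1 →
    s i * s j = s j * s i
  braid : ∀ i, 1 ≤ i → i + 1 ≤ k - 1 →
    s i * s (i + 1) * s i = s (i + 1) * s i * s (i + 1)
  p_sq : ∀ i, 1 ≤ i → i ≤ k → p i * p i = (X : Polynomial ℤ) • p i
  q_sq : ∀ i, 1 ≤ i → i ≤ k - 1 → q i * q i = q i
  s_q : ∀ i, 1 ≤ i → i ≤ k - 1 → s i * q i = q i
  q_s : ∀ i, 1 ≤ i → i ≤ k - 1 → q i * s i = q i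
  s_pp : ∀ i, 1 ≤ i → i ≤ k - 1 → s i * (p i * p (i + 1)) = p i * p (i + 1)
  pp_s : ∀ i, 1 ≤ i → i ≤ k - 1 → p i * p (i + 1) * s i = p i * p (i + 1)
  p_comm : ∀ i j, 1 ≤ i → i ≤ k → 1 ≤ j → j ≤ k → p i * p j = p j * p i
  q_comm : ∀ i j, 1 ≤ i → i ≤ k - 1 → 1 ≤ j → j ≤ k - 1 → q i * q j = q j * q i
  q_p : ∀ i j, 1 ≤ i → i ≤ k - 1 → 1 ≤ j → j ≤ k → j ≠ i → j ≠ i + 1 →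
    q i * p j = p j * q i
  s_p : ∀ i j, 1 ≤ i → i ≤ k - 1 → 1 ≤ j → j ≤ k → j ≠ i → j ≠ i + 1 →
    s i * p j = p j * s i
  s_q' : ∀ i j, 1 ≤ i → i ≤ k - 1 → 1 ≤ j → j ≤ k - 1 → j + 1 ≠ i → j ≠ i + 1 →
    s i * q j = q j * s i
  sps : ∀ i, 1 ≤ i → i ≤ k - 1 → s i * p i * s i = p (i + 1)
  sqs : ∀ i, 2 ≤ i → i ≤ k - 1 →
    s i * q (i - 1) * s i = s (i - 1) * q i * s (i - 1)
  qpq₁ : ∀ i, 1 ≤ i → i ≤ k - 1 → q i * p i * q i = q i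
  qpq₂ : ∀ i, 1 ≤ i → i ≤ k - 1 → q i * p (i + 1) * q i = q i
  pqp₁ : ∀ i, 2 ≤ i → i ≤ k → p i * q (i - 1) * p i = p i
  pqp₂ : ∀ i, 1 ≤ i → i ≤ k - 1 → p i * q i * p i = p i

namespace PartitionAlgebra

variable {k : ℕ} {A : Type*} [Ring A] [Algebra (Polynomial ℤ) A]

/-- `(P.LS i).1 = L_i` and `(P.LS i).2 = σ_i` (with the junk value `σ_0 := 1`). -/
def LS (P : PartitionAlgebra k A) : ℕ → A × A
  | 0 => (0, 1)
  | 1 => (P.p 1, 1)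
  | n + 2 =>
    let Lp := (P.LS (n + 1)).1
    let sp := (P.LS (n + 1)).2
    let Lpp := (P.LS n).1
    let snew : A :=
      if n = 0 then P.s 1
      else
        P.s n * P.s (n + 1) * sp * P.s (n + 1) * P.s n
          + P.s (n + 1) * P.q n * Lpp * P.s (n + 1) * P.q n * P.s (n + 1)
          + P.q n * Lpp * P.s (n + 1) * P.q n
          - P.s (n + 1) * P.q n * Lpp * P.s n * P.q (n + 1) * P.p (n + 1) * P.q n
          - P.q n * P.p (n + 1) * P.q (n + 1) * P.s n * Lpp * P.q n * P.s (n + 1)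
    (-(P.s (n + 1) * Lp * P.q (n + 1)) - P.q (n + 1) * Lp * P.s (n + 1)
        + P.q (n + 1) * Lp * P.p (n + 2) * P.q (n + 1)
        + P.s (n + 1) * Lp * P.s (n + 1) + snew,
      snew)

/-- The Jucys–Murphy element `L_i` of the partition algebra. -/
def L (P : PartitionAlgebra k A) (i : ℕ) : A := (P.LS i).1

/-- The element `σ_i` of the partition algebra. -/
def sig (P : PartitionAlgebra k A) (i : ℕ) : A := (P.LS i).2

/-- `(P.LSh i).1 = L_{i+1/2}` and `(P.LSh i).2 = σ_{i+1/2}`. -/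
def LSh (P : PartitionAlgebra k A) : ℕ → A × A
  | 0 => (0, 1)
  | 1 =>
    (-(P.L 1 * P.q 1) - P.q 1 * P.L 1 + P.q 1 * P.L 1 * P.p 1 * P.q 1
        + P.s 1 * (0 : A) * P.s 1 + 1, 1)
  | n + 2 =>
    let Lhp := (P.LSh (n + 1)).1
    let shp := (P.LSh (n + 1)).2
    let snew : A :=
      P.s (n + 1) * P.s (n + 2) * shp * P.s (n + 2) * P.s (n + 1)
        + P.q (n + 1) * P.L (n + 1) * P.s (n + 2) * P.q (n + 1) * P.s (n + 2)
        + P.s (n + 2) * P.q (n + 1) * P.L (n + 1) * P.s (n + 2) * P.q (n + 1)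
        - P.q (n + 1) * P.L (n + 1) * P.s (n + 1) * P.q (n + 2) * P.p (n + 2) * P.q (n + 1)
        - P.s (n + 2) * P.q (n + 1) * P.p (n + 2) * P.q (n + 2) * P.s (n + 1)
            * P.L (n + 1) * P.q (n + 1) * P.s (n + 2)
    (-(P.L (n + 2) * P.q (n + 2)) - P.q (n + 2) * P.L (n + 2)
        + P.q (n + 2) * P.L (n + 2) * P.p (n + 2) * P.q (n + 2)
        + P.s (n + 2) * Lhp * P.s (n + 2) + snew,
      snew)

/-- The half-integer Jucys–Murphy element `L_{i+1/2}` of the partition algebra. -/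
def Lh (P : PartitionAlgebra k A) (i : ℕ) : A := (P.LSh i).1

/-- The element `σ_{i+1/2}` of the partition algebra. -/
def sigH (P : PartitionAlgebra k A) (i : ℕ) : A := (P.LSh i).2

end PartitionAlgebra

/-- The relations used in passing from `L_i`, `σ_{i+1/2}` to `L_{i+1}`, `σ_{i+3/2}`, for
`s = s_i`, `t = s_{i+1}`, `q = p_{i+1/2}`, `r = p_{i+3/2}`, `b = p_{i+1}`, `c = p_{i+2}`,
`L = L_i` and `H = σ_{i+1/2}`. They are invariant under reversing products. -/
structure JMStep {A : Type*} [Ring A] (s t q r b c L H : A) : Prop where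
  ss : s * s = 1
  tt : t * t = 1
  braid : s * t * s = t * s * t
  sq : s * q = q
  qs : q * s = q
  tr : t * r = r
  rt : r * t = r
  conj : t * q * t = s * r * s
  qr : q * r = r * q
  tb : t * b = c * t
  bt : b * t = t * c
  sc : s * c = c * s
  qc : q * c = c * q
  qbq : q * b * q = q
  rbr : r * b * r = r
  brc : b * r * c = b * t
  crb : c * r * b = c * t
  sbs_t : s * b * s * t = t * s * b * s
  Lt : L * t = t * L
  Lr : L * r = r * L
  Lb : L * b = b * L
  Lc : L * c = c * L
  Hr : H * r = r * H
  Hc : H * c = c * H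
  Hs : H * s = s * H
  Hq : H * q = q * L * q
  qH : q * H = q * L * q
  sHb : s * H * b = L * q * b
  bHs : b * H * s = b * q * L

namespace JMStep

open MulOpposite

variable {A : Type*} [Ring A] {s t q r b c L H : A}

/-- The recursion producing `L_{i+1}`. -/
def nextL (s q b L H : A) : A :=
  -(s * L * q) - q * L * s + q * L * b * q + s * L * s + s * H

/-- The recursion producing `σ_{i+3/2}`, in a form invariant under reversing products. -/
def nextH (s t q L H : A) : A :=
  s * t * H * t * s + q * L * t * q * t + t * q * L * t * q - q * t * H * t - t * q * t * H

protected theorem op (h : JMStep s t q r b c L H) :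
    JMStep (op s) (op t) (op q) (op r) (op b) (op c) (op L) (op H) where
  ss := by simp only [← op_mul, h.ss, op_one]
  tt := by simp only [← op_mul, h.tt, op_one]
  braid := by simp only [← op_mul, ← mul_assoc, h.braid]
  sq := by simp only [← op_mul, h.qs]
  qs := by simp only [← op_mul, h.sq]
  tr := by simp only [← op_mul, h.rt]
  rt := by simp only [← op_mul, h.tr]
  conj := by simp only [← op_mul, ← mul_assoc, h.conj]
  qr := by simp only [← op_mul, h.qr]
  tb := by simp only [← op_mul, h.bt]
  bt := by simp only [← op_mul, h.tb]
  sc := by simp only [← op_mul, h.sc]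
  qc := by simp only [← op_mul, h.qc]
  qbq := by simp only [← op_mul, ← mul_assoc, h.qbq]
  rbr := by simp only [← op_mul, ← mul_assoc, h.rbr]
  brc := by simp only [← op_mul, ← mul_assoc, h.crb, h.tb]
  crb := by simp only [← op_mul, ← mul_assoc, h.brc, h.bt]
  sbs_t := by simp only [← op_mul, ← mul_assoc, h.sbs_t]
  Lt := by simp only [← op_mul, h.Lt]
  Lr := by simp only [← op_mul, h.Lr]
  Lb := by simp only [← op_mul, h.Lb]
  Lc := by simp only [← op_mul, h.Lc]
  Hr := by simp only [← op_mul, h.Hr]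
  Hc := by simp only [← op_mul, h.Hc]
  Hs := by simp only [← op_mul, h.Hs]
  Hq := by simp only [← op_mul, ← mul_assoc, h.qH]
  qH := by simp only [← op_mul, ← mul_assoc, h.Hq]
  sHb := by simp only [← op_mul, ← mul_assoc, h.bHs]
  bHs := by simp only [← op_mul, ← mul_assoc, h.sHb]

theorem tsr (h : JMStep s t q r b c L H) : t * s * r = q * t * s := by
  linear_combination (norm := noncomm_ring)
    -(t * h.conj * s) - t * s * r * h.ss + h.tt * q * t * s

theorem rst (h : JMStep s t q r b c L H) : r * s * t = s * t * q := by
  linear_combination (norm := noncomm_ring)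
    -(s * h.conj * t) - h.ss * r * s * t + s * t * q * h.tt

theorem rsr (h : JMStep s t q r b c L H) : r * s * r = q * r := by
  linear_combination (norm := noncomm_ring)
    -(r * s * h.tr) + h.rst * r + s * t * h.qr + s * h.tr * q - s * h.qr + h.sq * r

theorem H_tqt (h : JMStep s t q r b c L H) : H * t * q * t = t * q * t * H := by
  linear_combination (norm := noncomm_ring) H * h.conj + h.Hs * r * s + s * h.Hr * s
    + s * r * h.Hs - h.conj * H

/-- `s_{i+1} σ_{i+1/2} s_{i+1}` commutes with `p_{i+1/2}`. -/
theorem q_tHt (h : JMStep s t q r b c L H) : q * t * H * t = t * H * t * q := by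
  linear_combination (norm := noncomm_ring)
    -(h.tt * q * t * H * t) - t * h.H_tqt * t + t * H * t * q * h.tt

theorem L_s_r_c (h : JMStep s t q r b c L H) : L * s * r * c = t * s * H * b * t * s := by
  linear_combination (norm := noncomm_ring)
    -(L * h.tt * s * r * c) + L * t * h.tsr * c + h.Lt * q * t * s * c + t * L * q * t * h.sc
    - t * L * q * h.bt * s - t * h.sHb * t * s

theorem q_L_s_r_b_q (h : JMStep s t q r b c L H) :
    q * L * s * r * b * q = q * t * H * t := by
  linear_combination (norm := noncomm_ring)
    -(q * L * s * h.rt * b * q) + q * L * s * r * h.tb * q + q * h.L_s_r_c * t * q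
    - q * t * s * H * b * h.braid * q + q * t * s * H * b * s * t * h.sq
    - q * t * h.Hs * b * s * t * q + q * t * H * h.sbs_t * q + h.q_tHt * s * b * s * q
    + t * H * t * h.qs * b * s * q + t * H * t * q * b * h.sq + t * H * t * h.qbq - h.q_tHt

theorem q_b_r_s_L_q (h : JMStep s t q r b c L H) :
    q * b * r * s * L * q = q * t * H * t := by
  have := congrArg unop h.op.q_L_s_r_b_q
  simp only [unop_mul, unop_op, ← mul_assoc] at this
  rw [this, h.q_tHt]

theorem t_mul_nextH (h : JMStep s t q r b c L H) :
    t * nextH s t q L H = nextH s t q L H * t := by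
  have h₁ : t * s * t * H * t * s = s * t * H * t * s * t := by
    linear_combination (norm := noncomm_ring)
      -(h.braid * H * t * s) - s * t * h.Hs * t * s + s * t * H * h.braid
  unfold nextH
  linear_combination (norm := noncomm_ring) h₁ + h.tt * q * L * t * q
    - q * L * t * q * h.tt - h.tt * q * t * H + q * t * H * h.tt

theorem nextH_mul_r (h : JMStep s t q r b c L H) :
    nextH s t q L H * r = r * nextL s q b L H * r := by
  have h₁ : s * t * H * t * s * r = r * s * L * s * r := by
    linear_combination (norm := noncomm_ring) s * t * H * h.tsr + s * t * h.Hq * t * s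
      - h.rst * L * q * t * s - r * s * h.Lt * q * t * s - r * s * L * t * h.tsr
      + r * s * L * h.tt * s * r
  have h₂ : q * L * t * q * t * r = r * q * L * q := by
    linear_combination (norm := noncomm_ring) q * L * t * q * h.tr + q * L * t * h.qr
      + q * L * h.tr * q + q * h.Lr * q + h.qr * L * q
  have h₃ : t * q * L * t * q * r = r * q * L * q := by
    linear_combination (norm := noncomm_ring) t * q * L * t * h.qr + t * q * L * h.tr * q
      + t * q * h.Lr * q + t * h.qr * L * q + h.tr * q * L * q
  have h₄ : q * t * H * t * r = r * q * L * q := by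
    linear_combination (norm := noncomm_ring) q * t * H * h.tr + q * t * h.Hr
      + q * h.tr * H + h.qr * H + r * h.qH
  have h₅ : t * q * t * H * r = r * q * L * q := by
    linear_combination (norm := noncomm_ring) t * q * t * h.Hr + t * q * h.tr * H
      + t * h.qr * H + h.tr * q * H + r * h.qH
  have h₆ : r * s * L * q * r = r * q * L * q := by
    linear_combination (norm := noncomm_ring) r * s * L * h.qr + r * s * h.Lr * q
      + h.rsr * L * q + h.qr * L * q
  have h₇ : r * q * L * s * r = r * q * L * q := by
    linear_combination (norm := noncomm_ring) -(h.qr * L * s * r) - q * h.Lr * s * r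
      + q * L * h.rsr + q * L * h.qr + q * h.Lr * q + h.qr * L * q
  have h₈ : r * q * L * b * q * r = r * q * L * q := by
    linear_combination (norm := noncomm_ring) r * q * L * b * h.qr - h.qr * L * b * r * q
      - q * h.Lr * b * r * q + q * L * h.rbr * q + q * h.Lr * q + h.qr * L * q
  have h₉ : r * s * H * r = r * q * L * q := by
    linear_combination (norm := noncomm_ring) r * s * h.Hr + h.rsr * H + h.qr * H + r * h.qH
  unfold nextH nextL
  linear_combination (norm := noncomm_ring) h₁ + h₂ + h₃ - h₄ - h₅ + h₆ + h₇ - h₈ - h₉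

theorem t_nextH_c (h : JMStep s t q r b c L H) :
    t * nextH s t q L H * c = nextL s q b L H * r * c := by
  have h₁ : t * s * t * H * t * s * c = s * L * s * r * c := by
    linear_combination (norm := noncomm_ring) -(s * h.L_s_r_c) - h.braid * H * t * s * c
      + s * t * s * H * t * h.sc - s * t * s * H * h.bt * s
  have h₂ : t * q * t * H * t * c = s * L * q * r * c := by
    linear_combination (norm := noncomm_ring) -(t * q * t * H * h.bt) + h.conj * H * b * t
      + s * r * h.sHb * t - s * h.Lr * q * b * t - s * L * h.qr * b * t
      + s * L * q * r * h.bt + s * L * q * h.rt * c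
  have h₃ : q * t * H * c = q * L * s * r * c := by
    linear_combination (norm := noncomm_ring) -(q * h.L_s_r_c) + q * t * h.Hs * b * t * s
      - q * t * H * s * h.bt * s + q * t * H * s * t * h.sc - q * t * H * h.braid * c
      - h.q_tHt * s * t * c - t * H * t * h.qs * t * c + h.q_tHt * t * c - q * t * H * h.tt * c
  have h₄ : q * L * t * q * c = q * L * b * q * r * c := by
    linear_combination (norm := noncomm_ring) q * L * t * h.qc - q * L * h.bt * q
      - q * L * b * h.qr * c - q * L * b * r * h.qc - q * L * h.brc * q
  have h₅ : t * q * L * t * q * t * c = s * H * r * c := by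
    linear_combination (norm := noncomm_ring) -(t * q * L * t * q * h.bt)
      + t * q * h.Lt * q * b * t + h.conj * L * q * b * t - s * r * s * h.sHb * t
      + s * r * h.ss * H * b * t - s * h.Hr * b * t + s * H * r * h.bt + s * H * h.rt * c
  unfold nextH nextL
  linear_combination (norm := noncomm_ring) h₁ - h₂ - h₃ + h₄ + h₅
    + h.tt * q * L * t * q * c - h.tt * q * t * H * c

theorem unop_nextL (h : JMStep s t q r b c L H) :
    unop (nextL (op s) (op q) (op b) (op L) (op H)) = nextL s q b L H := by
  simp only [nextL, unop_mul, unop_op, unop_add, unop_sub, unop_neg]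
  linear_combination (norm := noncomm_ring) h.Hs - q * h.Lb * q

theorem unop_nextH (h : JMStep s t q r b c L H) :
    unop (nextH (op s) (op t) (op q) (op L) (op H)) = nextH s t q L H := by
  simp only [nextH, unop_mul, unop_op, unop_add, unop_sub]
  linear_combination (norm := noncomm_ring)
    h.q_tHt - h.H_tqt - t * q * h.Lt * q - q * h.Lt * q * t

theorem r_mul_nextH (h : JMStep s t q r b c L H) :
    r * nextH s t q L H = r * nextL s q b L H * r := by
  have := congrArg unop h.op.nextH_mul_r
  simpa only [unop_mul, unop_op, ← mul_assoc, h.unop_nextL, h.unop_nextH] using this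

theorem c_nextH_t (h : JMStep s t q r b c L H) :
    c * nextH s t q L H * t = c * r * nextL s q b L H := by
  have := congrArg unop h.op.t_nextH_c
  simpa only [unop_mul, unop_op, ← mul_assoc, h.unop_nextL, h.unop_nextH] using this

theorem commute_nextL {x : A} (hs : Commute x s) (hq : Commute x q) (hb : Commute x b)
    (hL : Commute x L) (hH : Commute x H) : Commute x (nextL s q b L H) :=
  (((((hs.mul_right hL).mul_right hq).neg_right.sub_right ((hq.mul_right hL).mul_right hs)).add_right
    (((hq.mul_right hL).mul_right hb).mul_right hq)).add_right
    ((hs.mul_right hL).mul_right hs)).add_right (hs.mul_right hH)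

theorem commute_nextH (h : JMStep s t q r b c L H) {x : A} (hs : Commute x s) (hq : Commute x q)
    (hr : Commute x r) (hL : Commute x L) (hH : Commute x H) (htH : Commute x (t * H * t)) :
    Commute x (nextH s t q L H) := by
  have hsrs := (hs.mul_right hr).mul_right hs
  have key : nextH s t q L H = s * (t * H * t) * s + q * L * (s * r * s) + s * r * s * L * q
      - q * (t * H * t) - s * r * s * H := by
    unfold nextH
    linear_combination (norm := noncomm_ring)
      q * L * h.conj + t * q * h.Lt * q + h.conj * L * q - h.conj * H
  rw [key]
  exact ((((hs.mul_right htH).mul_right hs).add_right ((hq.mul_right hL).mul_right hsrs)).add_right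
    ((hsrs.mul_right hL).mul_right hq)).sub_right (hq.mul_right htH) |>.sub_right
    (hsrs.mul_right hH)

end JMStep

theorem commute_conj_of_conj_eq {A : Type*} [Ring A] {t v r u y : A} (ht : t * t = 1)
    (h : v * r * v = t * u * t) (hr : Commute r y) (hv : Commute v y) :
    Commute u (t * y * t) := by
  have h₁ : t * u * t * y = y * (t * u * t) := h ▸ ((hv.mul_left hr).mul_left hv).eq
  change u * (t * y * t) = t * y * t * u
  linear_combination (norm := noncomm_ring)
    -(ht * u * t * y * t) + t * h₁ * t + t * y * t * u * ht

/-- The relations relating `M = L_{i-1/2}`, `L = L_i` and `H = σ_{i+1/2}` to `s = s_i`,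
`q = p_{i+1/2}`, `a = p_i` and `b = p_{i+1}`, where `Z = z p_i`. -/
structure JMPair {A : Type*} [Ring A] (s q a b L M H Z : A) : Prop where
  ss : s * s = 1
  sq : s * q = q
  qs : q * s = q
  qq : q * q = q
  sa : s * a = b * s
  as : a * s = s * b
  aqb : a * q * b = a * s
  bqa : b * q * a = s * a
  bqb : b * q * b = b
  qaq : q * a * q = q
  Lb : L * b = b * L
  Mq : M * q = q * M
  Hs : H * s = s * H
  Hq : H * q = q * L * q
  qH : q * H = q * L * q
  sHb : s * H * b = L * q * b
  bHs : b * H * s = b * q * L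
  MLa : (M + L) * a = Z
  aML : a * (M + L) = Z

namespace JMPair

open JMStep

variable {A : Type*} [Ring A] {s q a b L M H Z : A}

/-- The recursion producing `L_{i+1/2}`. -/
def nextM (s q a L M H : A) : A := -(L * q) - q * L + q * L * a * q + s * M * s + H

theorem q_L_a_q (h : JMPair s q a b L M H Z) : q * L * a * q = q * Z * q - M * q := by
  linear_combination (norm := noncomm_ring) q * h.MLa * q + h.Mq * a * q - M * h.qaq

theorem q_a_L_q (h : JMPair s q a b L M H Z) : q * a * L * q = q * Z * q - M * q := by
  linear_combination (norm := noncomm_ring) q * h.aML * q - q * a * h.Mq - h.qaq * M + h.Mq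

theorem next_mul_b (h : JMPair s q a b L M H Z) :
    (nextM s q a L M H + nextL s q b L H) * b = s * Z * s := by
  unfold nextM nextL
  linear_combination (norm := noncomm_ring) s * h.MLa * s + h.sHb - h.ss * H * b + s * h.sHb
    + q * L * h.aqb + q * L * h.as + q * L * h.bqb - s * M * h.as - s * L * h.as

theorem b_mul_next (h : JMPair s q a b L M H Z) :
    b * (nextM s q a L M H + nextL s q b L H) = s * Z * s := by
  unfold nextM nextL
  linear_combination (norm := noncomm_ring) s * h.aML * s + b * h.q_L_a_q - b * h.q_a_L_q
    + h.bqa * L * q + h.sa * L * q - h.sa * M * s - h.sa * L * s + b * q * h.Lb * q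
    + h.bqb * L * q - b * H * h.ss + h.bHs * s - b * h.Hs + h.bHs

theorem next_mul_q (h : JMPair s q a b L M H Z) :
    (L + nextM s q a L M H) * q = q * Z * q := by
  unfold nextM
  linear_combination (norm := noncomm_ring) h.Hq + s * M * h.sq + s * h.Mq + h.sq * M - h.Mq
    + h.q_L_a_q - L * h.qq + q * L * a * h.qq

theorem q_mul_next (h : JMPair s q a b L M H Z) :
    q * (L + nextM s q a L M H) = q * Z * q := by
  unfold nextM
  linear_combination (norm := noncomm_ring) h.qH - h.qq * L + h.qq * L * a * q + h.q_L_a_q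
    + h.qs * M * s - h.Mq * s + M * h.qs

theorem sum_mul_s (h : JMPair s q a b L M H Z) :
    (M + L + nextM s q a L M H + nextL s q b L H) * s =
      s * (M + L + nextM s q a L M H + nextL s q b L H) := by
  unfold nextM nextL
  linear_combination (norm := noncomm_ring) h.Hs + s * h.Hs + s * M * h.ss - h.ss * M * s
    - h.ss * L * s + s * L * h.ss - L * h.qs + h.ss * L * q - q * L * h.ss + h.sq * L
    + h.sq * L * s - s * L * h.qs + q * L * a * h.qs - h.sq * L * a * q + q * L * b * h.qs
    - h.sq * L * b * q

end JMPair

namespace PartitionAlgebra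

open JMStep JMPair

variable {k : ℕ} {A : Type*} [Ring A] [Algebra (Polynomial ℤ) A] (P : PartitionAlgebra k A)

theorem p_q_p_succ {i : ℕ} (h₁ : 1 ≤ i) (h₂ : i ≤ k - 1) :
    P.p i * P.q i * P.p (i + 1) = P.p i * P.s i := by
  have e₁ := P.sps i h₁ h₂
  have e₂ := P.q_s i h₁ h₂
  have e₃ := P.pqp₂ i h₁ h₂
  linear_combination (norm := noncomm_ring)
    -(P.p i * P.q i * e₁) + P.p i * e₂ * P.p i * P.s i + e₃ * P.s i

theorem p_succ_q_p {i : ℕ} (h₁ : 1 ≤ i) (h₂ : i ≤ k - 1) :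
    P.p (i + 1) * P.q i * P.p i = P.s i * P.p i := by
  have e₁ := P.sps i h₁ h₂
  have e₂ := P.s_q i h₁ h₂
  have e₃ := P.pqp₂ i h₁ h₂
  linear_combination (norm := noncomm_ring)
    -(e₁ * P.q i * P.p i) + P.s i * P.p i * e₂ * P.p i + P.s i * e₃

theorem s_p_self {i : ℕ} (h₁ : 1 ≤ i) (h₂ : i ≤ k - 1) :
    P.s i * P.p i = P.p (i + 1) * P.s i := by
  have e₁ := P.sps i h₁ h₂
  have e₂ := P.s_sq i h₁ h₂
  linear_combination (norm := noncomm_ring) e₁ * P.s i - P.s i * P.p i * e₂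

theorem p_s_self {i : ℕ} (h₁ : 1 ≤ i) (h₂ : i ≤ k - 1) :
    P.p i * P.s i = P.s i * P.p (i + 1) := by
  have e₁ := P.sps i h₁ h₂
  have e₂ := P.s_sq i h₁ h₂
  linear_combination (norm := noncomm_ring) P.s i * e₁ - e₂ * P.p i * P.s i

theorem Lh_succ (n : ℕ) : P.Lh (n + 1) = -(P.L (n + 1) * P.q (n + 1))
    - P.q (n + 1) * P.L (n + 1) + P.q (n + 1) * P.L (n + 1) * P.p (n + 1) * P.q (n + 1)
    + P.s (n + 1) * P.Lh n * P.s (n + 1) + P.sigH (n + 1) := by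
  cases n <;> rfl

/-- The properties of `L_a` and `σ_{a+1/2}` that propagate along the recursion. -/
structure JMInvariant (a : ℕ) : Prop where
  sig_succ : P.sig (a + 1) = P.s a * P.sigH a
  L_q : ∀ j, a < j → j ≤ k - 1 → Commute (P.q j) (P.L a)
  L_s : ∀ j, a < j → j ≤ k - 1 → Commute (P.s j) (P.L a)
  L_p : ∀ j, a < j → j ≤ k → Commute (P.p j) (P.L a)
  H_q : ∀ j, a < j → j ≤ k - 1 → Commute (P.q j) (P.sigH a)
  H_s : ∀ j, a + 1 < j → j ≤ k - 1 → Commute (P.s j) (P.sigH a)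
  H_p : ∀ j, a + 1 < j → j ≤ k → Commute (P.p j) (P.sigH a)
  Hs : P.sigH a * P.s a = P.s a * P.sigH a
  Hq : P.sigH a * P.q a = P.q a * P.L a * P.q a
  qH : P.q a * P.sigH a = P.q a * P.L a * P.q a
  sHp : P.s a * P.sigH a * P.p (a + 1) = P.L a * P.q a * P.p (a + 1)
  pHs : P.p (a + 1) * P.sigH a * P.s a = P.p (a + 1) * P.q a * P.L a

/-- Conjugation by `s_b` of an element commuting with `p_{j+1/2}` for `j ≥ b` and with `s_{b+1}`
commutes with `p_{j+1/2}` for `j > b`. -/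
theorem commute_q_conj {b j : ℕ} {y : A} (h₁ : b + 1 < j) (h₂ : j ≤ k - 1)
    (hr : b + 1 ≤ k - 1 → Commute (P.q (b + 1)) y) (hv : b + 2 ≤ k - 1 → Commute (P.s (b + 2)) y)
    (hj : Commute (P.q j) y) : Commute (P.q j) (P.s (b + 1) * y * P.s (b + 1)) := by
  obtain rfl | h₃ := eq_or_ne j (b + 2)
  · exact commute_conj_of_conj_eq (P.s_sq (b + 1) (by omega) (by omega))
      (P.sqs (b + 2) (by omega) h₂) (hr (by omega)) (hv h₂)
  · have ht : Commute (P.q j) (P.s (b + 1)) :=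
      (P.s_q' (b + 1) j (by omega) (by omega) (by omega) h₂ (by omega) (by omega)).symm
    exact (ht.mul_right hj).mul_right ht

variable {P}

namespace JMInvariant

theorem jmStep {a : ℕ} (h : JMInvariant P a) (h₁ : 1 ≤ a) (h₂ : a + 1 ≤ k - 1) :
    JMStep (P.s a) (P.s (a + 1)) (P.q a) (P.q (a + 1)) (P.p (a + 1)) (P.p (a + 2))
      (P.L a) (P.sigH a) where
  ss := P.s_sq a h₁ (by omega)
  tt := P.s_sq (a + 1) (by omega) h₂
  braid := P.braid a h₁ h₂
  sq := P.s_q a h₁ (by omega)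
  qs := P.q_s a h₁ (by omega)
  tr := P.s_q (a + 1) (by omega) h₂
  rt := P.q_s (a + 1) (by omega) h₂
  conj := P.sqs (a + 1) (by omega) h₂
  qr := P.q_comm a (a + 1) h₁ (by omega) (by omega) h₂
  tb := P.s_p_self (by omega) h₂
  bt := P.p_s_self (by omega) h₂
  sc := P.s_p a (a + 2) h₁ (by omega) (by omega) (by omega) (by omega) (by omega)
  qc := P.q_p a (a + 2) h₁ (by omega) (by omega) (by omega) (by omega) (by omega)
  qbq := P.qpq₂ a h₁ (by omega)
  rbr := P.qpq₁ (a + 1) (by omega) h₂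
  brc := P.p_q_p_succ (by omega) h₂
  crb := (P.p_succ_q_p (by omega) h₂).trans (P.s_p_self (by omega) h₂)
  sbs_t := by
    have e₁ := P.p_s_self h₁ (by omega : a ≤ k - 1)
    have e₂ := P.s_sq a h₁ (by omega)
    have e₃ := P.s_p (a + 1) a (by omega) h₂ h₁ (by omega) (by omega) (by omega)
    linear_combination (norm := noncomm_ring) -(e₁ * P.s a * P.s (a + 1))
      + P.p a * e₂ * P.s (a + 1) - e₃ - P.s (a + 1) * P.p a * e₂ + P.s (a + 1) * e₁ * P.s a
  Lt := (h.L_s _ (by omega) h₂).symm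
  Lr := (h.L_q _ (by omega) h₂).symm
  Lb := (h.L_p _ (by omega) (by omega)).symm
  Lc := (h.L_p _ (by omega) (by omega)).symm
  Hr := (h.H_q _ (by omega) h₂).symm
  Hc := (h.H_p _ (by omega) (by omega)).symm
  Hs := h.Hs
  Hq := h.Hq
  qH := h.qH
  sHb := h.sHp
  bHs := h.pHs

theorem L_succ {n : ℕ} (h : JMInvariant P (n + 1)) :
    P.L (n + 2) =
      nextL (P.s (n + 1)) (P.q (n + 1)) (P.p (n + 2)) (P.L (n + 1)) (P.sigH (n + 1)) := by
  rw [nextL, ← h.sig_succ]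
  rfl

theorem sigH_succ {n : ℕ} (h : JMInvariant P (n + 1)) (hn : n + 2 ≤ k - 1) :
    P.sigH (n + 2) =
      nextH (P.s (n + 1)) (P.s (n + 2)) (P.q (n + 1)) (P.L (n + 1)) (P.sigH (n + 1)) := by
  have hS := h.jmStep (by omega) hn
  have e : P.sigH (n + 2) = P.s (n + 1) * P.s (n + 2) * P.sigH (n + 1) * P.s (n + 2) * P.s (n + 1)
        + P.q (n + 1) * P.L (n + 1) * P.s (n + 2) * P.q (n + 1) * P.s (n + 2)
        + P.s (n + 2) * P.q (n + 1) * P.L (n + 1) * P.s (n + 2) * P.q (n + 1)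
        - P.q (n + 1) * P.L (n + 1) * P.s (n + 1) * P.q (n + 2) * P.p (n + 2) * P.q (n + 1)
        - P.s (n + 2) * P.q (n + 1) * P.p (n + 2) * P.q (n + 2) * P.s (n + 1)
            * P.L (n + 1) * P.q (n + 1) * P.s (n + 2) := rfl
  have e₁ := hS.q_L_s_r_b_q
  have e₂ := hS.q_b_r_s_L_q
  have e₃ := hS.tt
  rw [e, nextH]
  linear_combination (norm := noncomm_ring) -e₁ - P.s (n + 2) * e₂ * P.s (n + 2)
    - P.s (n + 2) * P.q (n + 1) * P.s (n + 2) * P.sigH (n + 1) * e₃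

theorem sig_succ_succ {n : ℕ} (h : JMInvariant P (n + 1)) (hn : n + 2 ≤ k - 1) :
    P.sig (n + 3) = P.s (n + 2) * P.sigH (n + 2) := by
  have hS := h.jmStep (by omega) hn
  have e₁ := hS.q_L_s_r_b_q
  have e₂ := hS.q_b_r_s_L_q
  have e₃ := hS.tt
  have e : P.sig (n + 3) = P.s (n + 1) * P.s (n + 2) * P.sig (n + 2) * P.s (n + 2) * P.s (n + 1)
          + P.s (n + 2) * P.q (n + 1) * P.L (n + 1) * P.s (n + 2) * P.q (n + 1) * P.s (n + 2)
          + P.q (n + 1) * P.L (n + 1) * P.s (n + 2) * P.q (n + 1)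
          - P.s (n + 2) * P.q (n + 1) * P.L (n + 1) * P.s (n + 1) * P.q (n + 2) * P.p (n + 2)
              * P.q (n + 1)
          - P.q (n + 1) * P.p (n + 2) * P.q (n + 2) * P.s (n + 1) * P.L (n + 1) * P.q (n + 1)
              * P.s (n + 2) := rfl
  rw [e, h.sigH_succ hn, h.sig_succ, nextH]
  linear_combination (norm := noncomm_ring)
    hS.braid * P.sigH (n + 1) * P.s (n + 2) * P.s (n + 1)
    - P.s (n + 2) * e₁ - e₂ * P.s (n + 2)
    - e₃ * P.q (n + 1) * P.L (n + 1) * P.s (n + 2) * P.q (n + 1)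
    + e₃ * P.q (n + 1) * P.s (n + 2) * P.sigH (n + 1)
    - P.q (n + 1) * P.s (n + 2) * P.sigH (n + 1) * e₃

theorem succ {n : ℕ} (h : JMInvariant P (n + 1)) (hn : n + 2 ≤ k - 1) :
    JMInvariant P (n + 2) := by
  have hS := h.jmStep (by omega) hn
  have hL := h.L_succ
  have hH := h.sigH_succ hn
  refine ⟨h.sig_succ_succ hn, fun j h₁ h₂ => ?_, fun j h₁ h₂ => ?_, fun j h₁ h₂ => ?_,
    fun j h₁ h₂ => ?_, fun j h₁ h₂ => ?_, fun j h₁ h₂ => ?_, ?_, ?_, ?_, ?_, ?_⟩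
  · rw [hL]
    exact commute_nextL
      (P.s_q' (n + 1) j (by omega) (by omega) (by omega) h₂ (by omega) (by omega)).symm
      (P.q_comm _ _ (by omega) h₂ (by omega) (by omega))
      (P.q_p _ _ (by omega) h₂ (by omega) (by omega) (by omega) (by omega))
      (h.L_q j (by omega) h₂) (h.H_q j (by omega) h₂)
  · rw [hL]
    exact commute_nextL
      (P.s_comm _ _ (by omega) h₂ (by omega) (by omega) (by omega) (by omega))
      (P.s_q' _ _ (by omega) h₂ (by omega) (by omega) (by omega) (by omega))
      (P.s_p _ _ (by omega) h₂ (by omega) (by omega) (by omega) (by omega))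
      (h.L_s j (by omega) h₂) (h.H_s j (by omega) h₂)
  · rw [hL]
    exact commute_nextL
      (P.s_p (n + 1) j (by omega) (by omega) (by omega) h₂ (by omega) (by omega)).symm
      (P.q_p (n + 1) j (by omega) (by omega) (by omega) h₂ (by omega) (by omega)).symm
      (P.p_comm _ _ (by omega) h₂ (by omega) (by omega))
      (h.L_p j (by omega) h₂) (h.H_p j (by omega) h₂)
  · rw [hH]
    refine hS.commute_nextH
      (P.s_q' (n + 1) j (by omega) (by omega) (by omega) h₂ (by omega) (by omega)).symm
      (P.q_comm _ _ (by omega) h₂ (by omega) (by omega))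
      (P.q_comm _ _ (by omega) h₂ (by omega) (by omega))
      (h.L_q j (by omega) h₂) (h.H_q j (by omega) h₂) ?_
    exact P.commute_q_conj h₁ h₂ (h.H_q _ (by omega)) (h.H_s _ (by omega))
      (h.H_q j (by omega) h₂)
  · rw [hH]
    have hst := P.s_comm j (n + 2) (by omega) h₂ (by omega) (by omega) (by omega) (by omega)
    have hsH := h.H_s j (by omega) h₂
    exact hS.commute_nextH
      (P.s_comm _ _ (by omega) h₂ (by omega) (by omega) (by omega) (by omega))
      (P.s_q' _ _ (by omega) h₂ (by omega) (by omega) (by omega) (by omega))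
      (P.s_q' _ _ (by omega) h₂ (by omega) (by omega) (by omega) (by omega))
      (h.L_s j (by omega) h₂) hsH ((Commute.mul_right hst hsH).mul_right hst)
  · rw [hH]
    have hpt := (P.s_p (n + 2) j (by omega) hn (by omega) h₂ (by omega) (by omega)).symm
    have hpH := h.H_p j (by omega) h₂
    exact hS.commute_nextH
      (P.s_p (n + 1) j (by omega) (by omega) (by omega) h₂ (by omega) (by omega)).symm
      (P.q_p (n + 1) j (by omega) (by omega) (by omega) h₂ (by omega) (by omega)).symm
      (P.q_p (n + 2) j (by omega) (by omega) (by omega) h₂ (by omega) (by omega)).symm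
      (h.L_p j (by omega) h₂) hpH ((Commute.mul_right hpt hpH).mul_right hpt)
  · rw [hH]
    exact hS.t_mul_nextH.symm
  · rw [hH, hL]
    exact hS.nextH_mul_r
  · rw [hH, hL]
    exact hS.r_mul_nextH
  · rw [hH, hL]
    exact hS.t_nextH_c
  · rw [hH, hL]
    exact hS.c_nextH_t

end JMInvariant

variable (P)

theorem jmInvariant_one (hk : 1 ≤ k - 1) : JMInvariant P 1 := by
  have hL : P.L 1 = P.p 1 := rfl
  have hH : P.sigH 1 = 1 := rfl
  refine ⟨?_, fun j h₁ h₂ => ?_, fun j h₁ h₂ => ?_, fun j h₁ h₂ => ?_,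
    fun j h₁ h₂ => ?_, fun j h₁ h₂ => ?_, fun j h₁ h₂ => ?_, ?_, ?_, ?_, ?_, ?_⟩ <;>
    simp only [hL, hH, Commute.one_right, mul_one, one_mul]
  · rfl
  · exact P.q_p _ _ (by omega) h₂ (by omega) (by omega) (by omega) (by omega)
  · exact P.s_p _ _ (by omega) h₂ (by omega) (by omega) (by omega) (by omega)
  · exact P.p_comm _ _ (by omega) h₂ (by omega) (by omega)
  · exact (P.qpq₁ 1 le_rfl hk).symm
  · exact (P.qpq₁ 1 le_rfl hk).symm
  · rw [P.p_q_p_succ le_rfl hk, P.p_s_self le_rfl hk]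
  · rw [P.p_succ_q_p le_rfl hk, P.s_p_self le_rfl hk]

theorem jmInvariant (n : ℕ) (hn : n + 1 ≤ k - 1) : JMInvariant P (n + 1) := by
  induction n with
  | zero => exact P.jmInvariant_one hn
  | succ n ih => exact (ih (by omega)).succ hn

/-- `L_{n+1/2}` commutes with the generators to its right. -/
theorem commute_Lh (n : ℕ) :
    (∀ j, n < j → j ≤ k - 1 → Commute (P.q j) (P.Lh n)) ∧
      ∀ j, n + 1 < j → j ≤ k - 1 → Commute (P.s j) (P.Lh n) := by
  induction n with
  | zero => exact ⟨fun j _ _ => Commute.zero_right _, fun j _ _ => Commute.zero_right _⟩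
  | succ n ih =>
    rw [P.Lh_succ]
    refine ⟨fun j h₁ h₂ => ?_, fun j h₁ h₂ => ?_⟩
    · have h := P.jmInvariant n (by omega)
      have hL := h.L_q j h₁ h₂
      have hq : Commute (P.q j) (P.q (n + 1)) :=
        P.q_comm _ _ (by omega) h₂ (by omega) (by omega)
      have hp : Commute (P.q j) (P.p (n + 1)) :=
        P.q_p _ _ (by omega) h₂ (by omega) (by omega) (by omega) (by omega)
      have hM := P.commute_q_conj h₁ h₂ (ih.1 _ (by omega)) (ih.2 _ (by omega))
        (ih.1 j (by omega) h₂)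
      exact ((((hL.mul_right hq).neg_right.sub_right (hq.mul_right hL)).add_right
        (((hq.mul_right hL).mul_right hp).mul_right hq)).add_right hM).add_right
        (h.H_q j h₁ h₂)
    · have h := P.jmInvariant n (by omega)
      have hL := h.L_s j (by omega) h₂
      have hq : Commute (P.s j) (P.q (n + 1)) :=
        P.s_q' _ _ (by omega) h₂ (by omega) (by omega) (by omega) (by omega)
      have hp : Commute (P.s j) (P.p (n + 1)) :=
        P.s_p _ _ (by omega) h₂ (by omega) (by omega) (by omega) (by omega)
      have hs : Commute (P.s j) (P.s (n + 1)) :=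
        P.s_comm _ _ (by omega) h₂ (by omega) (by omega) (by omega) (by omega)
      exact ((((hL.mul_right hq).neg_right.sub_right (hq.mul_right hL)).add_right
        (((hq.mul_right hL).mul_right hp).mul_right hq)).add_right
        ((hs.mul_right (ih.2 j (by omega) h₂)).mul_right hs)).add_right (h.H_s j h₁ h₂)

theorem jmPair {n : ℕ} (hn : n + 1 ≤ k - 1)
    (h₁ : (P.Lh n + P.L (n + 1)) * P.p (n + 1) = (X : Polynomial ℤ) • P.p (n + 1))
    (h₂ : P.p (n + 1) * (P.Lh n + P.L (n + 1)) = (X : Polynomial ℤ) • P.p (n + 1)) :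
    JMPair (P.s (n + 1)) (P.q (n + 1)) (P.p (n + 1)) (P.p (n + 2)) (P.L (n + 1)) (P.Lh n)
      (P.sigH (n + 1)) ((X : Polynomial ℤ) • P.p (n + 1)) where
  ss := P.s_sq _ (by omega) hn
  sq := P.s_q _ (by omega) hn
  qs := P.q_s _ (by omega) hn
  sa := P.s_p_self (by omega) hn
  as := P.p_s_self (by omega) hn
  qq := P.q_sq _ (by omega) hn
  aqb := P.p_q_p_succ (by omega) hn
  bqa := P.p_succ_q_p (by omega) hn
  bqb := P.pqp₁ (n + 2) (by omega) (by omega)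
  qaq := P.qpq₁ _ (by omega) hn
  Lb := ((P.jmInvariant n hn).L_p _ (by omega) (by omega)).symm
  Mq := ((P.commute_Lh n).1 _ (by omega) hn).symm
  Hs := (P.jmInvariant n hn).Hs
  Hq := (P.jmInvariant n hn).Hq
  qH := (P.jmInvariant n hn).qH
  sHb := (P.jmInvariant n hn).sHp
  bHs := (P.jmInvariant n hn).pHs
  MLa := h₁
  aML := h₂

theorem Lh_add_L_mul_p (n : ℕ) (hn : n + 1 ≤ k) :
    (P.Lh n + P.L (n + 1)) * P.p (n + 1) = (X : Polynomial ℤ) • P.p (n + 1) ∧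
      P.p (n + 1) * (P.Lh n + P.L (n + 1)) = (X : Polynomial ℤ) • P.p (n + 1) := by
  induction n with
  | zero =>
    have h : P.Lh 0 + P.L 1 = P.p 1 := zero_add _
    simp only [zero_add, h, P.p_sq 1 le_rfl hn, and_self]
  | succ n ih =>
    have hn' : n + 1 ≤ k - 1 := by omega
    obtain ⟨ih₁, ih₂⟩ := ih (by omega)
    have h := P.jmPair hn' ih₁ ih₂
    have hz : P.s (n + 1) * ((X : Polynomial ℤ) • P.p (n + 1)) * P.s (n + 1)
        = (X : Polynomial ℤ) • P.p (n + 2) := by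
      rw [mul_smul_comm, smul_mul_assoc, P.sps _ (by omega) hn']
    rw [P.Lh_succ, (P.jmInvariant n hn').L_succ, ← hz]
    exact ⟨h.next_mul_b, h.b_mul_next⟩

end PartitionAlgebra

/-- Proposition 3.9: for `1 ≤ i ≤ k-1`,
`(L_{i+1/2} + L_{i+1}) p_{i+1} = p_{i+1} (L_{i+1/2} + L_{i+1}) = z p_{i+1}`,
`(L_i + L_{i+1/2}) p_{i+1/2} = p_{i+1/2} (L_i + L_{i+1/2}) = z p_{i+1/2}`, and
`(L_{i-1/2} + L_i + L_{i+1/2} + L_{i+1}) s_i = s_i (L_{i-1/2} + L_i + L_{i+1/2} + L_{i+1})`. -/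
theorem partitionAlgebra_jm_sums {k : ℕ} (hk : 2 ≤ k) {A : Type*} [Ring A]
    [Algebra (Polynomial ℤ) A] (P : PartitionAlgebra k A) :
    ∀ i, 1 ≤ i → i ≤ k - 1 →
      ((P.Lh i + P.L (i + 1)) * P.p (i + 1) = P.p (i + 1) * (P.Lh i + P.L (i + 1)) ∧
        P.p (i + 1) * (P.Lh i + P.L (i + 1)) = (X : Polynomial ℤ) • P.p (i + 1)) ∧
      ((P.L i + P.Lh i) * P.q i = P.q i * (P.L i + P.Lh i) ∧
        P.q i * (P.L i + P.Lh i) = (X : Polynomial ℤ) • P.q i) ∧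
      (P.Lh (i - 1) + P.L i + P.Lh i + P.L (i + 1)) * P.s i =
        P.s i * (P.Lh (i - 1) + P.L i + P.Lh i + P.L (i + 1)) := by
  intro i hi hik
  obtain ⟨n, rfl⟩ : ∃ n, i = n + 1 := ⟨i - 1, by omega⟩
  obtain ⟨h₁, h₂⟩ := P.Lh_add_L_mul_p n (by omega)
  obtain ⟨h₃, h₄⟩ := P.Lh_add_L_mul_p (n + 1) (by omega)
  have h := P.jmPair hik h₁ h₂
  have hz : P.q (n + 1) * ((X : Polynomial ℤ) • P.p (n + 1)) * P.q (n + 1)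
      = (X : Polynomial ℤ) • P.q (n + 1) := by
    rw [mul_smul_comm, smul_mul_assoc, h.qaq]
  refine ⟨⟨h₃.trans h₄.symm, h₄⟩, ?_, ?_⟩
  · rw [P.Lh_succ, ← hz]
    exact ⟨h.next_mul_q.trans h.q_mul_next.symm, h.q_mul_next⟩
  · rw [Nat.add_sub_cancel, P.Lh_succ, (P.jmInvariant n hik).L_succ]
    exact h.sum_mul_s
end

section
/- In the partition algebra A_k(z): for every i with 1 ≤ i ≤ k−1 one has (σ_{i+1/2})² = 1 and (σ_{i+1})² = 1, i.e. each σ_{i+1/2} and each σ_{i+1} is an involution. -/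
open Polynomial

section Ring

variable {A : Type*} [Ring A]

/-- Transport of an identity along conjugation by an invertible element. -/
theorem SemiconjBy.eq_of_eq {g h x y x' y' : A} (hg : g * h = 1) (hx : SemiconjBy g x x')
    (hy : SemiconjBy g y y') (e : x = y) : x' = y' := by
  have h1 : x' * g = y' * g := by rw [← hx.eq, ← hy.eq, e]
  calc x' = x' * g * h := by rw [mul_assoc, hg, mul_one]
    _ = y' * g * h := by rw [h1]
    _ = y' := by rw [mul_assoc, hg, mul_one]

theorem SemiconjBy.commute_of_commute {g h x y x' y' : A} (hg : g * h = 1)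
    (hx : SemiconjBy g x x') (hy : SemiconjBy g y y') (e : Commute x y) : Commute x' y' :=
  SemiconjBy.eq_of_eq hg (hx.mul_right hy) (hy.mul_right hx) e.eq

theorem SemiconjBy.of_involution_mul {g : A} (hg : g * g = 1) (x : A) :
    SemiconjBy g x (g * x * g) := by
  simp [SemiconjBy, mul_assoc, hg]

theorem SemiconjBy.symm_of_involution {g x y : A} (hg : g * g = 1) (h : SemiconjBy g x y) :
    SemiconjBy g y x := by
  have h' : g * x = y * g := h
  calc g * y = g * (y * g) * g := by simp [mul_assoc, hg]
    _ = x * g := by rw [← h', ← mul_assoc, hg, one_mul]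

/-- The value swap in one tensor position, controlled by two further positions: with `Q` and `Q'`
the equality tests against the two controls and `p` the summation over that position. -/
def flipOp (Q Q' p : A) : A := 1 - Q - Q' + Q * p * Q' + Q' * p * Q

theorem SemiconjBy.flipOp {g Q Q' p R R' r : A} (h : SemiconjBy g Q R) (h' : SemiconjBy g Q' R')
    (hp : SemiconjBy g p r) : SemiconjBy g (flipOp Q Q' p) (flipOp R R' r) :=
  ((((SemiconjBy.one_right g).sub_right h).sub_right h').add_right
    ((h.mul_right hp).mul_right h')).add_right ((h'.mul_right hp).mul_right h)

theorem flipOp_symm (Q Q' p : A) : flipOp Q Q' p = flipOp Q' Q p := by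
  unfold _root_.flipOp
  abel

theorem flipOp_mul_self {Q Q' p : A} (hQ : Q * Q = Q) (hQ' : Q' * Q' = Q')
    (hc : Q' * Q = Q * Q') (h1 : Q * p * Q = Q) (h2 : Q' * p * Q' = Q')
    (h3 : p * Q * p = p) (h4 : p * Q' * p = p) :
    flipOp Q Q' p * flipOp Q Q' p = 1 := by
  have a1 : Q * (Q * p * Q') = Q * p * Q' := by simp only [← mul_assoc, hQ]
  have a2 : Q * (Q' * p * Q) = Q * Q' := by
    rw [show Q * (Q' * p * Q) = (Q * Q') * p * Q by noncomm_ring, ← hc,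
      show Q' * Q * p * Q = Q' * (Q * p * Q) by noncomm_ring, h1]
  have a3 : Q' * (Q * p * Q') = Q * Q' := by
    rw [show Q' * (Q * p * Q') = (Q' * Q) * p * Q' by noncomm_ring, hc,
      show Q * Q' * p * Q' = Q * (Q' * p * Q') by noncomm_ring, h2]
  have a4 : Q' * (Q' * p * Q) = Q' * p * Q := by simp only [← mul_assoc, hQ']
  have b1 : Q * p * Q' * Q = Q * Q' := by rw [mul_assoc, hc, ← mul_assoc, h1]
  have b2 : Q' * p * Q * Q = Q' * p * Q := by rw [mul_assoc, hQ]
  have b3 : Q * p * Q' * Q' = Q * p * Q' := by rw [mul_assoc, hQ']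
  have b4 : Q' * p * Q * Q' = Q * Q' := by rw [mul_assoc, ← hc, ← mul_assoc, h2, hc]
  have c1 : Q * p * Q' * (Q * p * Q') = Q * Q' := by
    rw [show Q * p * Q' * (Q * p * Q') = Q * p * Q' * Q * (p * Q') by noncomm_ring, b1,
      mul_assoc, ← mul_assoc Q', h2]
  have c2 : Q' * p * Q * (Q' * p * Q) = Q * Q' := by
    rw [show Q' * p * Q * (Q' * p * Q) = Q' * p * Q * Q' * (p * Q) by noncomm_ring, b4,
      ← hc, mul_assoc, ← mul_assoc Q, h1]
  have c3 : Q * p * Q' * (Q' * p * Q) = Q := by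
    rw [show Q * p * Q' * (Q' * p * Q) = Q * (p * (Q' * Q') * p) * Q by noncomm_ring, hQ', h4, h1]
  have c4 : Q' * p * Q * (Q * p * Q') = Q' := by
    rw [show Q' * p * Q * (Q * p * Q') = Q' * (p * (Q * Q) * p) * Q' by noncomm_ring, hQ, h3, h2]
  unfold flipOp
  generalize Q * p * Q' = E at *
  generalize Q' * p * Q = F at *
  simp only [mul_add, add_mul, mul_sub, sub_mul, mul_one, one_mul, hQ, hQ', hc, a1, a2, a3, a4,
    b1, b2, b3, b4, c1, c2, c3, c4]
  abel

/-- The algebraic core of the inductive step for `SigHInvariant.q_mul_L_mul_qskip`.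
In the names, `a, b, c, d` are four consecutive positions, `s` swaps `a` and `b`, and `qxy` is
the equality test on `x` and `y`. -/
theorem key_step {s τ L v pa pb qab qac qad qbc qbd : A}
    (ss : s * s = 1) (s_qab : s * qab = qab) (qab_s : qab * s = qab)
    (s_qac : s * qac = qbc * s) (s_qad : s * qad = qbd * s) (s_pa : s * pa = pb * s)
    (ab_ac : qab * qac = qab * qbc)
    (ac_bc : qac * qbc = qab * qbc) (bc_ab : qbc * qab = qab * qbc)
    (ad_ab : qad * qab = qab * qbd)
    (ad_bd : qad * qbd = qab * qbd) (bc_ad : qbc * qad = qad * qbc)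
    (pb_ad : pb * qad = qad * pb) (pa_bc : pa * qbc = qbc * pa)
    (pa_ab_pb : pa * qab * pb = pa * s) (ad_pa_ad : qad * pa * qad = qad)
    (v_s : v * s = s * v) (v_ab : v * qab = qab * v)
    (hτ : τ * (qac * qbd) = v * (qac * qbd)) (τ_ac : τ * qac = qac * τ)
    (key : qac * L * qad = v * (qac * pa * qad)) :
    qbc * (-(s * L * qab) - qab * L * s + qab * L * pb * qab + s * L * s + s * τ) * qbd
      = v * flipOp qac qad pa * (qbc * pb * qbd) := by
  have bc_s : qbc * s = s * qac := s_qac.symm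
  have s_bd : s * qbd = qad * s := by
    calc s * qbd = s * (qbd * s) * s := by simp only [mul_assoc, ss, mul_one]
      _ = qad * s := by rw [← s_qad, ← mul_assoc, ss, one_mul]
  have s_pb : s * pb = pa * s := by
    calc s * pb = s * (pb * s) * s := by simp only [mul_assoc, ss, mul_one]
      _ = pa * s := by rw [← s_pa, ← mul_assoc, ss, one_mul]
  have t0 : qbc * (s * L * s) * qbd = v * (qbc * pb * qbd) := by
    calc qbc * (s * L * s) * qbd = (qbc * s) * L * (s * qbd) := by simp only [mul_assoc]
      _ = s * (qac * L * qad) * s := by rw [bc_s, s_bd]; simp only [mul_assoc]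
      _ = v * (s * qac * pa * qad * s) := by rw [key, ← mul_assoc s, ← v_s]; simp only [mul_assoc]
      _ = v * (qbc * pb * (s * (qad * s))) := by
        rw [s_qac, mul_assoc qbc, s_pa]; simp only [mul_assoc]
      _ = v * (qbc * pb * qbd) := by rw [← s_bd, ← mul_assoc s, ss, one_mul]
  have t1 : qbc * (qab * L * s) * qbd = v * (qac * (qbc * pb * qbd)) := by
    calc qbc * (qab * L * s) * qbd = (qbc * qab) * L * (s * qbd) := by simp only [mul_assoc]
      _ = qab * (qac * L * qad) * s := by
        rw [bc_ab, ← ab_ac, s_bd]; simp only [mul_assoc]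
      _ = v * ((qab * qac) * (pa * (qad * s))) := by
        rw [key, ← mul_assoc qab, ← v_ab]; simp only [mul_assoc]
      _ = v * (qbc * qab * (s * pb) * qbd) := by
        rw [← s_bd, ab_ac, ← bc_ab, s_pb]; simp only [mul_assoc]
      _ = v * (qbc * qab * pb * qbd) := by
        rw [show qbc * qab * (s * pb) = qbc * (qab * s) * pb by simp only [mul_assoc], qab_s]
      _ = v * (qac * (qbc * pb * qbd)) := by
        rw [bc_ab, ← ac_bc]; simp only [mul_assoc]
  have t2 : qbc * (s * L * qab) * qbd = v * (qad * (qbc * pb * qbd)) := by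
    calc qbc * (s * L * qab) * qbd = (qbc * s) * L * (qab * qbd) := by simp only [mul_assoc]
      _ = s * (qac * L * qad) * qab := by
        rw [bc_s, ← ad_ab]; simp only [mul_assoc]
      _ = v * (s * qac * pa * (qad * qab)) := by
        rw [key, ← mul_assoc s, ← v_s]; simp only [mul_assoc]
      _ = v * (qbc * pb * ((s * qab) * qbd)) := by
        rw [s_qac, mul_assoc qbc, s_pa, ad_ab]; simp only [mul_assoc]
      _ = v * (qbc * (pb * qad) * qbd) := by
        rw [s_qab, ← ad_bd]; simp only [mul_assoc]
      _ = v * (qad * (qbc * pb * qbd)) := by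
        rw [pb_ad, ← mul_assoc qbc, bc_ad]; simp only [mul_assoc]
  have t3 : qbc * (qab * L * pb * qab) * qbd = v * (qac * pa * qad * (qbc * pb * qbd)) := by
    calc qbc * (qab * L * pb * qab) * qbd = (qbc * qab) * (L * pb) * (qab * qbd) := by
          simp only [mul_assoc]
      _ = qab * qac * L * (pb * qad) * qab := by
        rw [bc_ab, ← ab_ac, ← ad_ab]; simp only [mul_assoc]
      _ = qab * (qac * L * qad) * pb * qab := by rw [pb_ad]; simp only [mul_assoc]
      _ = v * ((qab * qac) * pa * qad * pb * qab) := by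
        rw [key, ← mul_assoc qab, ← v_ab]; simp only [mul_assoc]
      _ = v * (qac * (pa * qbc) * (pb * qad) * qab) := by
        rw [ab_ac, ← ac_bc, pa_bc, pb_ad]; simp only [mul_assoc]
      _ = v * (qac * pa * (qbc * (pb * qad) * qbd)) := by
        simp only [mul_assoc]; rw [ad_ab, ← ad_bd]
      _ = v * (qac * pa * qad * (qbc * pb * qbd)) := by
        rw [pb_ad, ← mul_assoc qbc, bc_ad]; simp only [mul_assoc]
  have e4 : qad * pa * qac * (qbc * pb * qbd) = s * qac * qbd := by
    calc qad * pa * qac * (qbc * pb * qbd) = qad * pa * (qac * qbc) * pb * qbd := by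
          simp only [mul_assoc]
      _ = qad * (pa * qbc) * qab * pb * qbd := by rw [ac_bc, ← bc_ab]; simp only [mul_assoc]
      _ = (qad * qbc) * (pa * qab * pb) * qbd := by rw [pa_bc]; simp only [mul_assoc]
      _ = qbc * (qad * pa * qad) * s := by
        rw [pa_ab_pb, ← bc_ad, mul_assoc _ (pa * s), mul_assoc pa, s_bd]; simp only [mul_assoc]
      _ = s * qac * qbd := by rw [ad_pa_ad, mul_assoc, ← s_bd, s_qac, mul_assoc]
  have t4 : qbc * (s * τ) * qbd = v * (qad * pa * qac * (qbc * pb * qbd)) := by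
    calc qbc * (s * τ) * qbd = (qbc * s) * τ * qbd := by simp only [mul_assoc]
      _ = s * (τ * (qac * qbd)) := by rw [bc_s, mul_assoc s, ← τ_ac]; simp only [mul_assoc]
      _ = v * (s * qac * qbd) := by rw [hτ, ← mul_assoc s, ← v_s]; simp only [mul_assoc]
      _ = _ := by rw [e4]
  rw [flipOp]
  simp only [mul_add, add_mul, mul_sub, sub_mul, mul_neg, neg_mul, mul_one] at *
  rw [t0, t1, t2, t3, t4]
  simp only [mul_assoc]
  abel

end Ring

namespace PartitionAlgebra

variable {k : ℕ} {A : Type*} [Ring A] [Algebra (Polynomial ℤ) A]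

theorem sig_two (P : PartitionAlgebra k A) : P.sig 2 = P.s 1 := by
  simp [sig, LS]

theorem sigH_one (P : PartitionAlgebra k A) : P.sigH 1 = 1 := rfl

theorem L_one (P : PartitionAlgebra k A) : P.L 1 = P.p 1 := rfl

theorem L_add_two (P : PartitionAlgebra k A) (n : ℕ) :
    P.L (n + 2) = -(P.s (n + 1) * P.L (n + 1) * P.q (n + 1))
      - P.q (n + 1) * P.L (n + 1) * P.s (n + 1)
      + P.q (n + 1) * P.L (n + 1) * P.p (n + 2) * P.q (n + 1)
      + P.s (n + 1) * P.L (n + 1) * P.s (n + 1) + P.sig (n + 2) := by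
  simp only [L, sig, LS]

theorem sig_add_three (P : PartitionAlgebra k A) (n : ℕ) :
    P.sig (n + 3) =
      P.s (n + 1) * P.s (n + 2) * P.sig (n + 2) * P.s (n + 2) * P.s (n + 1)
        + P.s (n + 2) * P.q (n + 1) * P.L (n + 1) * P.s (n + 2) * P.q (n + 1) * P.s (n + 2)
        + P.q (n + 1) * P.L (n + 1) * P.s (n + 2) * P.q (n + 1)
        - P.s (n + 2) * P.q (n + 1) * P.L (n + 1) * P.s (n + 1) * P.q (n + 2) * P.p (n + 2)
          * P.q (n + 1)
        - P.q (n + 1) * P.p (n + 2) * P.q (n + 2) * P.s (n + 1) * P.L (n + 1) * P.q (n + 1)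
          * P.s (n + 2) := by
  simp only [L, sig]
  conv_lhs => rw [LS]
  simp

theorem sigH_add_two (P : PartitionAlgebra k A) (n : ℕ) :
    P.sigH (n + 2) =
      P.s (n + 1) * P.s (n + 2) * P.sigH (n + 1) * P.s (n + 2) * P.s (n + 1)
        + P.q (n + 1) * P.L (n + 1) * P.s (n + 2) * P.q (n + 1) * P.s (n + 2)
        + P.s (n + 2) * P.q (n + 1) * P.L (n + 1) * P.s (n + 2) * P.q (n + 1)
        - P.q (n + 1) * P.L (n + 1) * P.s (n + 1) * P.q (n + 2) * P.p (n + 2) * P.q (n + 1)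
        - P.s (n + 2) * P.q (n + 1) * P.p (n + 2) * P.q (n + 2) * P.s (n + 1)
            * P.L (n + 1) * P.q (n + 1) * P.s (n + 2) := by
  simp only [sigH]
  conv_lhs => rw [LSh]

theorem s_mul_sigH (P : PartitionAlgebra k A) (n : ℕ) (hn : n + 1 ≤ k - 1) :
    P.s (n + 1) * P.sigH (n + 1) = P.sig (n + 2) := by
  induction n with
  | zero => rw [sigH_one, sig_two, mul_one]
  | succ n ih =>
    have hb := P.braid (n + 1) (by omega) hn
    have hs := P.s_sq (n + 2) (by omega) hn
    have s_cancel : ∀ x, P.s (n + 2) * (P.s (n + 2) * x) = x := fun x => by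
      rw [← mul_assoc, hs, one_mul]
    rw [sig_add_three, sigH_add_two, ← ih (by omega)]
    have e : P.s (n + 2) * (P.s (n + 1) * P.s (n + 2) * P.sigH (n + 1) * P.s (n + 2) * P.s (n + 1))
        = P.s (n + 1) * P.s (n + 2) * (P.s (n + 1) * P.sigH (n + 1)) * P.s (n + 2)
          * P.s (n + 1) := by
      simp only [← mul_assoc]
      rw [← hb]
    simp only [mul_add, mul_sub, e]
    simp only [mul_assoc, s_cancel]

/-- Anything commuting with the generators of `A_n` commutes with `L_n` and `σ_n`. -/
theorem commute_L_and_sig (P : PartitionAlgebra k A) {x : A} (n : ℕ)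
    (hp : ∀ j, 1 ≤ j → j ≤ n + 1 → Commute x (P.p j))
    (hq : ∀ j, 1 ≤ j → j ≤ n → Commute x (P.q j))
    (hs : ∀ j, 1 ≤ j → j ≤ n → Commute x (P.s j)) :
    Commute x (P.L (n + 1)) ∧ Commute x (P.sig (n + 1)) := by
  induction n using Nat.strong_induction_on with
  | _ n ih =>
    match n with
    | 0 => exact ⟨hp 1 le_rfl le_rfl, Commute.one_right x⟩
    | 1 =>
      have hL := (ih 0 (by omega) (fun j h h' => hp j h (by omega))
        (fun j h h' => hq j h (by omega)) (fun j h h' => hs j h (by omega))).1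
      have h2 : Commute x (P.sig 2) := by rw [sig_two]; exact hs 1 le_rfl le_rfl
      have p2 := hp 2 (by omega) (by omega)
      have q1 := hq 1 (by omega) (by omega)
      have s1 := hs 1 (by omega) (by omega)
      refine ⟨?_, h2⟩
      rw [L_add_two]
      exact (((((s1.mul_right hL).mul_right q1).neg_right.sub_right
        ((q1.mul_right hL).mul_right s1)).add_right
        (((q1.mul_right hL).mul_right p2).mul_right q1)).add_right
        ((s1.mul_right hL).mul_right s1)).add_right h2
    | n + 2 =>
      have hL0 := (ih n (by omega) (fun j h h' => hp j h (by omega))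
        (fun j h h' => hq j h (by omega)) (fun j h h' => hs j h (by omega))).1
      obtain ⟨hL, hS⟩ := ih (n + 1) (by omega) (fun j h h' => hp j h (by omega))
        (fun j h h' => hq j h (by omega)) (fun j h h' => hs j h (by omega))
      have p3 := hp (n + 3) (by omega) (by omega)
      have p2 := hp (n + 2) (by omega) (by omega)
      have q1 := hq (n + 1) (by omega) (by omega)
      have q2 := hq (n + 2) (by omega) (by omega)
      have s1 := hs (n + 1) (by omega) (by omega)
      have s2 := hs (n + 2) (by omega) (by omega)
      have h3 : Commute x (P.sig (n + 3)) := by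
        rw [sig_add_three]
        exact (((((((s1.mul_right s2).mul_right hS).mul_right s2).mul_right s1).add_right
          (((((s2.mul_right q1).mul_right hL0).mul_right s2).mul_right q1).mul_right s2)).add_right
          (((q1.mul_right hL0).mul_right s2).mul_right q1)).sub_right
          ((((((s2.mul_right q1).mul_right hL0).mul_right s1).mul_right q2).mul_right p2).mul_right
            q1)).sub_right
          ((((((q1.mul_right p2).mul_right q2).mul_right s1).mul_right hL0).mul_right q1).mul_right
            s2)
      refine ⟨?_, h3⟩
      rw [L_add_two]
      exact (((((s2.mul_right hL).mul_right q2).neg_right.sub_right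
        ((q2.mul_right hL).mul_right s2)).add_right
        (((q2.mul_right hL).mul_right p3).mul_right q2)).add_right
        ((s2.mul_right hL).mul_right s2)).add_right h3

section Far

variable (P : PartitionAlgebra k A)

theorem commute_s_L {n j : ℕ} (hn : n + 1 < j) (hj : j ≤ k - 1) :
    Commute (P.s j) (P.L (n + 1)) :=
  (P.commute_L_and_sig n
    (fun i _ _ => P.s_p j i (by omega) hj (by omega) (by omega) (by omega) (by omega))
    (fun i _ _ => P.s_q' j i (by omega) hj (by omega) (by omega) (by omega) (by omega))
    (fun i _ _ => P.s_comm j i (by omega) hj (by omega) (by omega) (by omega) (by omega))).1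

/-- Anything commuting with the generators of `A_{n+2}` commutes with `σ_{n+1+1/2}`. -/
theorem commute_sigH {x : A} {n : ℕ} (hn : n + 1 ≤ k - 1)
    (hp : ∀ j, 1 ≤ j → j ≤ n + 2 → Commute x (P.p j))
    (hq : ∀ j, 1 ≤ j → j ≤ n + 1 → Commute x (P.q j))
    (hs : ∀ j, 1 ≤ j → j ≤ n + 1 → Commute x (P.s j)) : Commute x (P.sigH (n + 1)) := by
  have e : P.sigH (n + 1) = P.s (n + 1) * P.sig (n + 2) := by
    rw [← P.s_mul_sigH n hn, ← mul_assoc, P.s_sq _ (by omega) hn, one_mul]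
  rw [e]
  exact (hs _ (by omega) le_rfl).mul_right (P.commute_L_and_sig (n + 1) hp hq hs).2

theorem commute_s_sigH {n j : ℕ} (hn : n + 2 < j) (hj : j ≤ k - 1) :
    Commute (P.s j) (P.sigH (n + 1)) :=
  P.commute_sigH (by omega)
    (fun i _ _ => P.s_p j i (by omega) hj (by omega) (by omega) (by omega) (by omega))
    (fun i _ _ => P.s_q' j i (by omega) hj (by omega) (by omega) (by omega) (by omega))
    (fun i _ _ => P.s_comm j i (by omega) hj (by omega) (by omega) (by omega) (by omega))

theorem commute_p_sigH {n j : ℕ} (hn : n + 2 < j) (hj : j ≤ k) :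
    Commute (P.p j) (P.sigH (n + 1)) :=
  P.commute_sigH (by omega)
    (fun i _ _ => P.p_comm j i (by omega) hj (by omega) (by omega))
    (fun i _ _ => (P.q_p i j (by omega) (by omega) (by omega) hj (by omega) (by omega)).symm)
    (fun i _ _ => (P.s_p i j (by omega) (by omega) (by omega) hj (by omega) (by omega)).symm)

theorem commute_q_sigH {n j : ℕ} (hn : n + 2 < j) (hj : j ≤ k - 1) :
    Commute (P.q j) (P.sigH (n + 1)) :=
  P.commute_sigH (by omega)
    (fun i _ _ => P.q_p j i (by omega) hj (by omega) (by omega) (by omega) (by omega))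
    (fun i _ _ => P.q_comm j i (by omega) hj (by omega) (by omega))
    (fun i _ _ => (P.s_q' i j (by omega) (by omega) (by omega) hj (by omega) (by omega)).symm)

end Far

/-- The equality test `q_{n,n+2}` on the positions `n` and `n + 2`. -/
def qskip (P : PartitionAlgebra k A) (n : ℕ) : A := P.s (n + 1) * P.q n * P.s (n + 1)

/-- The equality test `q_{n,n+3}` on the positions `n` and `n + 3`. -/
def qskip₂ (P : PartitionAlgebra k A) (n : ℕ) : A := P.s (n + 2) * P.qskip n * P.s (n + 2)

/-- The conjugate of `σ_{n+1/2}` controlled by the positions `n + 1` and `n + 2` and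
independent of the position `n`. -/
def sigHShift (P : PartitionAlgebra k A) (n : ℕ) : A :=
  P.s n * (P.s (n + 1) * P.sigH n * P.s (n + 1)) * P.s n

section ThreePositions

variable (P : PartitionAlgebra k A) {n : ℕ}

theorem semiconjBy_q_qskip (hk : n + 1 ≤ k - 1) :
    SemiconjBy (P.s (n + 1)) (P.q n) (P.qskip n) :=
  SemiconjBy.of_involution_mul (P.s_sq _ (by omega) hk) _

theorem semiconjBy_qskip_q (hk : n + 1 ≤ k - 1) :
    SemiconjBy (P.s (n + 1)) (P.qskip n) (P.q n) :=
  (P.semiconjBy_q_qskip hk).symm_of_involution (P.s_sq _ (by omega) hk)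

theorem semiconjBy_q_succ_qskip (hn : 1 ≤ n) (hk : n + 1 ≤ k - 1) :
    SemiconjBy (P.s n) (P.q (n + 1)) (P.qskip n) := by
  have h := P.sqs (n + 1) (by omega) hk
  rw [Nat.add_sub_cancel] at h
  rw [qskip, h]
  exact SemiconjBy.of_involution_mul (P.s_sq _ hn (by omega)) _

theorem semiconjBy_qskip_q_succ (hn : 1 ≤ n) (hk : n + 1 ≤ k - 1) :
    SemiconjBy (P.s n) (P.qskip n) (P.q (n + 1)) :=
  (P.semiconjBy_q_succ_qskip hn hk).symm_of_involution (P.s_sq _ hn (by omega))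

theorem semiconjBy_p_p_succ (hn : 1 ≤ n) (hk : n ≤ k - 1) :
    SemiconjBy (P.s n) (P.p n) (P.p (n + 1)) := by
  rw [← P.sps n hn hk]
  exact SemiconjBy.of_involution_mul (P.s_sq _ hn hk) _

theorem semiconjBy_p_succ_p (hn : 1 ≤ n) (hk : n ≤ k - 1) :
    SemiconjBy (P.s n) (P.p (n + 1)) (P.p n) :=
  (P.semiconjBy_p_p_succ hn hk).symm_of_involution (P.s_sq _ hn hk)

theorem commute_s_q_self (hn : 1 ≤ n) (hk : n ≤ k - 1) : Commute (P.s n) (P.q n) :=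
  (P.s_q n hn hk).trans (P.q_s n hn hk).symm

theorem commute_s_succ_p (hn : 1 ≤ n) (hk : n + 1 ≤ k - 1) : Commute (P.s (n + 1)) (P.p n) :=
  P.s_p _ _ (by omega) hk hn (by omega) (by omega) (by omega)

theorem commute_s_add_two_q (hn : 1 ≤ n) (hk : n + 2 ≤ k - 1) :
    Commute (P.s (n + 2)) (P.q n) :=
  P.s_q' _ _ (by omega) hk hn (by omega) (by omega) (by omega)

theorem commute_s_q_add_two (hn : 1 ≤ n) (hk : n + 2 ≤ k - 1) :
    Commute (P.s n) (P.q (n + 2)) :=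
  P.s_q' _ _ hn (by omega) (by omega) hk (by omega) (by omega)

theorem commute_s_add_two_p (hn : 1 ≤ n) (hk : n + 2 ≤ k - 1) :
    Commute (P.s (n + 2)) (P.p n) :=
  P.s_p _ _ (by omega) hk hn (by omega) (by omega) (by omega)

theorem commute_s_s_add_two (hn : 1 ≤ n) (hk : n + 2 ≤ k - 1) :
    Commute (P.s n) (P.s (n + 2)) :=
  P.s_comm _ _ hn (by omega) (by omega) hk (by omega) (by omega)

theorem commute_q_succ_p (hn : 1 ≤ n) (hk : n + 1 ≤ k - 1) : Commute (P.q (n + 1)) (P.p n) :=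
  P.q_p _ _ (by omega) hk hn (by omega) (by omega) (by omega)

theorem commute_q_q_succ (hn : 1 ≤ n) (hk : n + 1 ≤ k - 1) : Commute (P.q n) (P.q (n + 1)) :=
  P.q_comm _ _ hn (by omega) (by omega) hk

theorem q_mul_qskip (hn : 1 ≤ n) (hk : n + 1 ≤ k - 1) :
    P.q n * P.qskip n = P.q n * P.q (n + 1) := by
  have hs := P.s_sq n hn (by omega)
  have h := (P.semiconjBy_q_succ_qskip hn hk).eq
  calc P.q n * P.qskip n = P.q n * (P.s n * P.q (n + 1) * P.s n) := by
        rw [h, mul_assoc, hs, mul_one]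
    _ = (P.q n * P.s n) * P.q (n + 1) * P.s n := by simp only [mul_assoc]
    _ = P.q n * P.q (n + 1) := by
      rw [P.q_s n hn (by omega), (P.commute_q_q_succ hn hk).eq, mul_assoc,
        P.q_s n hn (by omega)]

theorem qskip_mul_q (hn : 1 ≤ n) (hk : n + 1 ≤ k - 1) :
    P.qskip n * P.q n = P.q n * P.q (n + 1) := by
  have hs := P.s_sq n hn (by omega)
  have h := (P.semiconjBy_q_succ_qskip hn hk).eq
  calc P.qskip n * P.q n = P.s n * P.q (n + 1) * (P.s n * P.q n) := by
        rw [h, mul_assoc, ← mul_assoc (P.s n), hs, one_mul]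
    _ = P.q n * P.q (n + 1) := by
      rw [P.s_q n hn (by omega), mul_assoc, ← (P.commute_q_q_succ hn hk).eq, ← mul_assoc,
        P.s_q n hn (by omega)]

theorem qskip_mul_q_succ (hn : 1 ≤ n) (hk : n + 1 ≤ k - 1) :
    P.qskip n * P.q (n + 1) = P.q n * P.q (n + 1) := by
  calc P.qskip n * P.q (n + 1) = P.s (n + 1) * P.q n * (P.s (n + 1) * P.q (n + 1)) := by
        rw [qskip, mul_assoc]
    _ = P.q n * P.q (n + 1) := by
      rw [P.s_q _ (by omega) hk, mul_assoc, (P.commute_q_q_succ hn hk).eq, ← mul_assoc,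
        P.s_q _ (by omega) hk]

theorem qskip_mul_self (hn : 1 ≤ n) (hk : n + 1 ≤ k - 1) :
    P.qskip n * P.qskip n = P.qskip n :=
  have h := P.semiconjBy_q_qskip hk
  SemiconjBy.eq_of_eq (P.s_sq _ (by omega) hk) (h.mul_right h) h (P.q_sq n hn (by omega))

theorem qskip_mul_p_mul_qskip (hn : 1 ≤ n) (hk : n + 1 ≤ k - 1) :
    P.qskip n * P.p n * P.qskip n = P.qskip n :=
  have h := P.semiconjBy_q_qskip hk
  SemiconjBy.eq_of_eq (P.s_sq _ (by omega) hk)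
    ((h.mul_right (P.commute_s_succ_p hn hk)).mul_right h) h (P.qpq₁ n hn (by omega))

theorem p_mul_qskip_mul_p (hn : 1 ≤ n) (hk : n + 1 ≤ k - 1) :
    P.p n * P.qskip n * P.p n = P.p n :=
  have h := P.commute_s_succ_p hn hk
  SemiconjBy.eq_of_eq (P.s_sq _ (by omega) hk)
    ((SemiconjBy.mul_right h (P.semiconjBy_q_qskip hk)).mul_right h) h (P.pqp₂ n hn (by omega))

theorem flipOp_q_qskip_mul_self (hn : 1 ≤ n) (hk : n + 1 ≤ k - 1) :
    flipOp (P.q n) (P.qskip n) (P.p n) * flipOp (P.q n) (P.qskip n) (P.p n) = 1 :=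
  flipOp_mul_self (P.q_sq n hn (by omega)) (P.qskip_mul_self hn hk)
    ((P.qskip_mul_q hn hk).trans (P.q_mul_qskip hn hk).symm) (P.qpq₁ n hn (by omega))
    (P.qskip_mul_p_mul_qskip hn hk) (P.pqp₂ n hn (by omega)) (P.p_mul_qskip_mul_p hn hk)

theorem p_mul_q_mul_p_succ (hn : 1 ≤ n) (hk : n ≤ k - 1) :
    P.p n * P.q n * P.p (n + 1) = P.p n * P.s n := by
  calc P.p n * P.q n * P.p (n + 1) = P.p n * (P.q n * P.s n) * P.p n * P.s n := by
        rw [← P.sps n hn hk]; simp only [mul_assoc]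
    _ = P.p n * P.s n := by rw [P.q_s n hn hk, P.pqp₂ n hn hk]

theorem s_mul_s_mul_inv (hn : 1 ≤ n) (hk : n + 1 ≤ k - 1) :
    P.s n * P.s (n + 1) * (P.s (n + 1) * P.s n) = 1 := by
  rw [mul_assoc, ← mul_assoc (P.s (n + 1)), P.s_sq _ (by omega) hk, one_mul,
    P.s_sq n hn (by omega)]

theorem semiconjBy_sigH_sigHShift (hn : 1 ≤ n) (hk : n + 1 ≤ k - 1) :
    SemiconjBy (P.s n * P.s (n + 1)) (P.sigH n) (P.sigHShift n) :=
  (SemiconjBy.of_involution_mul (P.s_sq n hn (by omega)) _).mul_left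
    (SemiconjBy.of_involution_mul (P.s_sq _ (by omega) hk) _)

theorem commute_sigHShift {x y : A} (hn : 1 ≤ n) (hk : n + 1 ≤ k - 1)
    (h : SemiconjBy (P.s n * P.s (n + 1)) x y) (hx : Commute x (P.sigH n)) :
    Commute y (P.sigHShift n) :=
  SemiconjBy.commute_of_commute (P.s_mul_s_mul_inv hn hk) h
    (P.semiconjBy_sigH_sigHShift hn hk) hx

theorem commute_p_sigHShift (hn : 1 ≤ n) (hk : n + 1 ≤ k - 1) :
    Commute (P.p n) (P.sigHShift n) := by
  refine P.commute_sigHShift hn hk ((P.semiconjBy_p_succ_p hn (by omega)).mul_left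
    (P.semiconjBy_p_succ_p (by omega) hk)) ?_
  obtain ⟨m, rfl⟩ := Nat.exists_eq_add_of_le' hn
  exact P.commute_p_sigH (by omega) (by omega)

end ThreePositions

/-- The inductive invariants of `σ_{n+1/2}` and `L_n`. -/
structure SigHInvariant (P : PartitionAlgebra k A) (n : ℕ) : Prop where
  commute_s : Commute (P.s n) (P.sigH n)
  commute_q : n + 1 ≤ k - 1 → Commute (P.q (n + 1)) (P.sigH n)
  q_mul_L_mul_qskip : n + 1 ≤ k - 1 →
    P.q n * P.L n * P.qskip n = P.sigHShift n * (P.q n * P.p n * P.qskip n)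

namespace SigHInvariant

variable {P : PartitionAlgebra k A} {n : ℕ}

theorem commute_qskip (h : P.SigHInvariant n) (hn : 1 ≤ n) (hk : n + 1 ≤ k - 1) :
    Commute (P.qskip n) (P.sigH n) :=
  SemiconjBy.commute_of_commute (P.s_sq n hn (by omega)) (P.semiconjBy_q_succ_qskip hn hk)
    h.commute_s (h.commute_q hk)

theorem commute_q_sigHShift (h : P.SigHInvariant n) (hn : 1 ≤ n) (hk : n + 1 ≤ k - 1) :
    Commute (P.q n) (P.sigHShift n) :=
  P.commute_sigHShift hn hk (SemiconjBy.mul_left (P.commute_s_q_self hn (by omega))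
    (P.semiconjBy_qskip_q hk)) (h.commute_qskip hn hk)

theorem commute_qskip_sigHShift (h : P.SigHInvariant n) (hn : 1 ≤ n) (hk : n + 1 ≤ k - 1) :
    Commute (P.qskip n) (P.sigHShift n) :=
  P.commute_sigHShift hn hk ((P.semiconjBy_q_succ_qskip hn hk).mul_left
    (P.commute_s_q_self (by omega) hk)) (h.commute_q hk)

theorem commute_s_sigHShift (h : P.SigHInvariant n) (hn : 1 ≤ n) (hk : n + 1 ≤ k - 1) :
    Commute (P.s (n + 1)) (P.sigHShift n) := by
  refine P.commute_sigHShift hn hk ?_ h.commute_s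
  rw [SemiconjBy, P.braid n hn hk, ← mul_assoc]

theorem commute_flipOp_sigHShift (h : P.SigHInvariant n) (hn : 1 ≤ n) (hk : n + 1 ≤ k - 1) :
    Commute (P.sigHShift n) (flipOp (P.q n) (P.qskip n) (P.p n)) :=
  SemiconjBy.flipOp (h.commute_q_sigHShift hn hk).symm (h.commute_qskip_sigHShift hn hk).symm
    (P.commute_p_sigHShift hn hk).symm

theorem sigH_succ (h : P.SigHInvariant n) (hn : 1 ≤ n) (hk : n + 1 ≤ k - 1) :
    P.sigH (n + 1) = P.sigHShift n * flipOp (P.q n) (P.qskip n) (P.p n) := by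
  have hts : Commute (P.s (n + 1)) (P.L n) := by
    obtain ⟨m, rfl⟩ := Nat.exists_eq_add_of_le' hn
    exact P.commute_s_L (by omega) hk
  have tt := P.s_sq (n + 1) (by omega) hk
  have hu := h.commute_s_sigHShift hn hk
  have hp := P.commute_s_succ_p hn hk
  have h1 := P.semiconjBy_q_qskip hk
  have h2 := P.semiconjBy_qskip_q hk
  have key := h.q_mul_L_mul_qskip hk
  have key' : P.qskip n * P.L n * P.q n = P.sigHShift n * (P.qskip n * P.p n * P.q n) :=
    SemiconjBy.eq_of_eq tt ((h1.mul_right hts).mul_right h2)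
      (SemiconjBy.mul_right hu ((h1.mul_right hp).mul_right h2)) key
  have hF : Commute (P.qskip n * P.p n * P.q n) (P.sigHShift n) :=
    ((h.commute_qskip_sigHShift hn hk).mul_left (P.commute_p_sigHShift hn hk)).mul_left
      (h.commute_q_sigHShift hn hk)
  have sb := (P.semiconjBy_q_succ_qskip hn hk).eq
  have sb' := (P.semiconjBy_qskip_q_succ hn hk).eq
  have sp := (P.semiconjBy_p_p_succ hn (by omega)).eq
  have sp' := (P.semiconjBy_p_succ_p hn (by omega)).eq
  have e2 : P.q n * P.L n * P.s (n + 1) * P.q n * P.s (n + 1)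
      = P.sigHShift n * (P.q n * P.p n * P.qskip n) := by
    rw [← key, qskip]; simp only [mul_assoc]
  have e3 : P.s (n + 1) * P.q n * P.L n * P.s (n + 1) * P.q n
      = P.sigHShift n * (P.qskip n * P.p n * P.q n) := by
    rw [← key', qskip, mul_assoc _ (P.L n), ← hts.eq]; simp only [mul_assoc]
  have e4 : P.q n * P.L n * P.s n * P.q (n + 1) * P.p (n + 1) * P.q n
      = P.sigHShift n * P.q n := by
    calc P.q n * P.L n * P.s n * P.q (n + 1) * P.p (n + 1) * P.q n
        = P.q n * P.L n * (P.s n * P.q (n + 1)) * P.p (n + 1) * P.q n := by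
          simp only [mul_assoc]
      _ = (P.q n * P.L n * P.qskip n) * P.s n * P.p (n + 1) * P.q n := by
          rw [sb]; simp only [mul_assoc]
      _ = P.sigHShift n * (P.q n * P.p n * (P.qskip n * P.s n) * P.p (n + 1) * P.q n) := by
          rw [key]; simp only [mul_assoc]
      _ = P.sigHShift n * (P.q n * (P.p n * P.s n) * P.q (n + 1) * P.p (n + 1) * P.q n) := by
          rw [← sb]; simp only [mul_assoc]
      _ = P.sigHShift n * (P.q n * P.s n * (P.p (n + 1) * P.q (n + 1) * P.p (n + 1))
            * P.q n) := by
          rw [← sp']; simp only [mul_assoc]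
      _ = P.sigHShift n * P.q n := by
          rw [P.pqp₂ _ (by omega) hk, P.q_s n hn (by omega), P.qpq₂ n hn (by omega)]
  have e5 : P.s (n + 1) * P.q n * P.p (n + 1) * P.q (n + 1) * P.s n * P.L n * P.q n * P.s (n + 1)
      = P.sigHShift n * P.qskip n := by
    calc P.s (n + 1) * P.q n * P.p (n + 1) * P.q (n + 1) * P.s n * P.L n * P.q n * P.s (n + 1)
        = P.s (n + 1) * P.q n * P.p (n + 1) * (P.q (n + 1) * P.s n) * P.L n * P.q n
            * P.s (n + 1) := by simp only [mul_assoc]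
      _ = P.s (n + 1) * P.q n * P.p (n + 1) * P.s n * (P.qskip n * P.L n * P.q n)
            * P.s (n + 1) := by rw [← sb']; simp only [mul_assoc]
      _ = P.s (n + 1) * P.q n * P.p (n + 1) * (P.s n * P.qskip n) * P.p n * P.q n
            * P.sigHShift n * P.s (n + 1) := by
          rw [key', ← hF.eq]; simp only [mul_assoc]
      _ = P.s (n + 1) * P.q n * P.p (n + 1) * P.q (n + 1) * (P.s n * P.p n) * P.q n
            * P.sigHShift n * P.s (n + 1) := by
          rw [sb']; simp only [mul_assoc]
      _ = P.s (n + 1) * P.q n * (P.p (n + 1) * P.q (n + 1) * P.p (n + 1)) * (P.s n * P.q n)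
            * P.sigHShift n * P.s (n + 1) := by
          rw [sp]; simp only [mul_assoc]
      _ = P.s (n + 1) * (P.q n * P.p (n + 1) * P.q n) * (P.sigHShift n * P.s (n + 1)) := by
          rw [P.pqp₂ _ (by omega) hk, P.s_q n hn (by omega)]; simp only [mul_assoc]
      _ = P.qskip n * P.sigHShift n := by
          rw [P.qpq₂ n hn (by omega), ← hu.eq, qskip]; simp only [mul_assoc]
      _ = P.sigHShift n * P.qskip n := (h.commute_qskip_sigHShift hn hk).eq
  have e1 : P.s n * P.s (n + 1) * P.sigH n * P.s (n + 1) * P.s n = P.sigHShift n := by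
    rw [sigHShift]; simp only [mul_assoc]
  have hrec : P.sigH (n + 1) =
      P.s n * P.s (n + 1) * P.sigH n * P.s (n + 1) * P.s n
        + P.q n * P.L n * P.s (n + 1) * P.q n * P.s (n + 1)
        + P.s (n + 1) * P.q n * P.L n * P.s (n + 1) * P.q n
        - P.q n * P.L n * P.s n * P.q (n + 1) * P.p (n + 1) * P.q n
        - P.s (n + 1) * P.q n * P.p (n + 1) * P.q (n + 1) * P.s n * P.L n * P.q n
          * P.s (n + 1) := by
    obtain ⟨m, rfl⟩ := Nat.exists_eq_add_of_le' hn
    exact P.sigH_add_two m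
  rw [hrec, e1, e2, e3, e4, e5, flipOp]
  simp only [mul_add, mul_sub, mul_one]
  abel

end SigHInvariant

section FourPositions

variable (P : PartitionAlgebra k A) {n : ℕ}

theorem semiconjBy_qskip_qskip₂ (hk : n + 2 ≤ k - 1) :
    SemiconjBy (P.s (n + 2)) (P.qskip n) (P.qskip₂ n) :=
  SemiconjBy.of_involution_mul (P.s_sq _ (by omega) hk) _

theorem semiconjBy_qskip₂_qskip (hk : n + 2 ≤ k - 1) :
    SemiconjBy (P.s (n + 2)) (P.qskip₂ n) (P.qskip n) :=
  (P.semiconjBy_qskip_qskip₂ hk).symm_of_involution (P.s_sq _ (by omega) hk)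

theorem semiconjBy_qskip_succ_qskip₂ (hn : 1 ≤ n) (hk : n + 2 ≤ k - 1) :
    SemiconjBy (P.s n) (P.qskip (n + 1)) (P.qskip₂ n) :=
  have h : SemiconjBy (P.s n) (P.s (n + 2)) (P.s (n + 2)) := P.commute_s_s_add_two hn hk
  (h.mul_right (P.semiconjBy_q_succ_qskip hn (by omega))).mul_right h

theorem semiconjBy_qskip₂_qskip_succ (hn : 1 ≤ n) (hk : n + 2 ≤ k - 1) :
    SemiconjBy (P.s n) (P.qskip₂ n) (P.qskip (n + 1)) :=
  (P.semiconjBy_qskip_succ_qskip₂ hn hk).symm_of_involution (P.s_sq _ hn (by omega))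

theorem commute_s_succ_qskip₂ (hn : 1 ≤ n) (hk : n + 2 ≤ k - 1) :
    Commute (P.s (n + 1)) (P.qskip₂ n) := by
  have hb := P.braid (n + 1) (by omega) hk
  have hc := (P.commute_s_add_two_q hn hk).eq
  calc P.s (n + 1) * P.qskip₂ n
      = (P.s (n + 1) * P.s (n + 2) * P.s (n + 1)) * P.q n * P.s (n + 1) * P.s (n + 2) := by
        rw [qskip₂, qskip]; simp only [mul_assoc]
    _ = P.s (n + 2) * P.s (n + 1) * (P.s (n + 2) * P.q n) * P.s (n + 1) * P.s (n + 2) := by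
        rw [hb]; simp only [mul_assoc]
    _ = P.s (n + 2) * P.s (n + 1) * P.q n * (P.s (n + 1 + 1) * P.s (n + 1) * P.s (n + 1 + 1)) := by
        rw [hc]; simp only [mul_assoc]
    _ = P.qskip₂ n * P.s (n + 1) := by
        rw [← hb, qskip₂, qskip]; simp only [mul_assoc]

theorem commute_qskip_qskip_succ (hn : 1 ≤ n) (hk : n + 2 ≤ k - 1) :
    Commute (P.qskip n) (P.qskip (n + 1)) :=
  SemiconjBy.commute_of_commute (P.s_sq (n + 1) (by omega) (by omega))
    (P.semiconjBy_q_qskip (by omega)) (P.semiconjBy_q_succ_qskip (by omega) hk)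
    (P.q_comm n (n + 2) hn (by omega) (by omega) hk)

theorem commute_q_succ_qskip₂ (hn : 1 ≤ n) (hk : n + 2 ≤ k - 1) :
    Commute (P.q (n + 1)) (P.qskip₂ n) :=
  SemiconjBy.commute_of_commute (P.s_sq n hn (by omega)) (P.semiconjBy_qskip_q_succ hn (by omega))
    (P.semiconjBy_qskip_succ_qskip₂ hn hk) (P.commute_qskip_qskip_succ hn hk)

theorem qskip₂_mul_qskip_succ (hn : 1 ≤ n) (hk : n + 2 ≤ k - 1) :
    P.qskip₂ n * P.qskip (n + 1) = P.q n * P.qskip (n + 1) :=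
  have h := P.semiconjBy_q_qskip (n := n + 1) hk
  SemiconjBy.eq_of_eq (P.s_sq (n + 2) (by omega) hk)
    ((P.semiconjBy_qskip_qskip₂ hk).mul_right h)
    (SemiconjBy.mul_right (P.commute_s_add_two_q hn hk) h) (P.qskip_mul_q_succ hn (by omega))

theorem qskip₂_mul_q (hn : 1 ≤ n) (hk : n + 2 ≤ k - 1) :
    P.qskip₂ n * P.q n = P.q n * P.qskip (n + 1) :=
  have h := P.commute_s_add_two_q hn hk
  SemiconjBy.eq_of_eq (P.s_sq (n + 2) (by omega) hk)
    ((P.semiconjBy_qskip_qskip₂ hk).mul_right h)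
    (SemiconjBy.mul_right h (P.semiconjBy_q_qskip (n := n + 1) hk))
    (P.qskip_mul_q hn (by omega))

theorem qskip₂_mul_p_mul_qskip₂ (hn : 1 ≤ n) (hk : n + 2 ≤ k - 1) :
    P.qskip₂ n * P.p n * P.qskip₂ n = P.qskip₂ n :=
  have h := P.semiconjBy_qskip_qskip₂ hk
  SemiconjBy.eq_of_eq (P.s_sq (n + 2) (by omega) hk)
    ((h.mul_right (P.commute_s_add_two_p hn hk)).mul_right h) h
    (P.qskip_mul_p_mul_qskip hn (by omega))

theorem commute_p_succ_qskip₂ (hn : 1 ≤ n) (hk : n + 2 ≤ k - 1) :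
    Commute (P.p (n + 1)) (P.qskip₂ n) := by
  have h : Commute (P.p n) (P.qskip (n + 1)) :=
    ((P.commute_s_add_two_p hn hk).symm.mul_right
      (P.commute_q_succ_p hn (by omega)).symm).mul_right (P.commute_s_add_two_p hn hk).symm
  exact SemiconjBy.commute_of_commute (P.s_sq n hn (by omega))
    (P.semiconjBy_p_p_succ hn (by omega)) (P.semiconjBy_qskip_succ_qskip₂ hn hk) h

/-- The involution exchanging the positions `n, n + 1` with `n + 2, n + 3`. -/
def blockSwap (n : ℕ) : A := P.s (n + 1) * (P.s (n + 2) * (P.s n * P.s (n + 1)))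

/-- The conjugate of `σ_{n+1/2}` controlled by the positions `n + 2` and `n + 3`. -/
def sigHShift₂ (n : ℕ) : A :=
  P.s (n + 1) * (P.s (n + 2) * P.sigHShift n * P.s (n + 2)) * P.s (n + 1)

theorem blockSwap_mul_self (hn : 1 ≤ n) (hk : n + 2 ≤ k - 1) :
    P.blockSwap n * P.blockSwap n = 1 := by
  have hc := (P.commute_s_s_add_two hn hk).eq
  have h1 := P.s_sq n hn (by omega)
  have h2 := P.s_sq (n + 1) (by omega) (by omega)
  have h3 := P.s_sq (n + 2) (by omega) hk
  calc P.blockSwap n * P.blockSwap n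
      = P.s (n + 1) * (P.s (n + 2) * (P.s n * (P.s (n + 1) * P.s (n + 1)) * P.s (n + 2)) * P.s n)
          * P.s (n + 1) := by rw [blockSwap]; simp only [mul_assoc]
    _ = P.s (n + 1) * ((P.s (n + 2) * P.s (n + 2)) * (P.s n * P.s n)) * P.s (n + 1) := by
        rw [h2, mul_one, hc]; simp only [mul_assoc]
    _ = 1 := by rw [h1, h3, mul_one, mul_one, h2]

theorem semiconjBy_sigH_sigHShift₂ (hn : 1 ≤ n) (hk : n + 2 ≤ k - 1) :
    SemiconjBy (P.blockSwap n) (P.sigH n) (P.sigHShift₂ n) := by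
  have h := P.semiconjBy_sigH_sigHShift hn (by omega)
  exact (SemiconjBy.of_involution_mul (P.s_sq (n + 1) (by omega) (by omega)) _).mul_left
    ((SemiconjBy.of_involution_mul (P.s_sq (n + 2) (by omega) hk) _).mul_left h)

theorem semiconjBy_sigHShift_sigHShift₂ (hk : n + 2 ≤ k - 1) :
    SemiconjBy (P.s (n + 1) * P.s (n + 2)) (P.sigHShift n) (P.sigHShift₂ n) :=
  (SemiconjBy.of_involution_mul (P.s_sq (n + 1) (by omega) (by omega)) _).mul_left
    (SemiconjBy.of_involution_mul (P.s_sq (n + 2) (by omega) hk) _)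

theorem semiconjBy_q_qskip_shift (hn : 1 ≤ n) (hk : n + 2 ≤ k - 1) :
    SemiconjBy (P.s (n + 1) * P.s (n + 2)) (P.q n) (P.qskip n) :=
  (P.semiconjBy_q_qskip (by omega)).mul_left (P.commute_s_add_two_q hn hk)

theorem semiconjBy_qskip_qskip₂_shift (hn : 1 ≤ n) (hk : n + 2 ≤ k - 1) :
    SemiconjBy (P.s (n + 1) * P.s (n + 2)) (P.qskip n) (P.qskip₂ n) :=
  SemiconjBy.mul_left (P.commute_s_succ_qskip₂ hn hk) (P.semiconjBy_qskip_qskip₂ hk)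

theorem semiconjBy_p_shift (hn : 1 ≤ n) (hk : n + 2 ≤ k - 1) :
    SemiconjBy (P.s (n + 1) * P.s (n + 2)) (P.p n) (P.p n) :=
  SemiconjBy.mul_left (P.commute_s_succ_p hn (by omega)) (P.commute_s_add_two_p hn hk)

theorem commute_sigHShift₂ {x y : A} (hn : 1 ≤ n) (hk : n + 2 ≤ k - 1)
    (h : SemiconjBy (P.blockSwap n) x y) (hx : Commute x (P.sigH n)) :
    Commute y (P.sigHShift₂ n) :=
  SemiconjBy.commute_of_commute (P.blockSwap_mul_self hn hk) h
    (P.semiconjBy_sigH_sigHShift₂ hn hk) hx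

theorem semiconjBy_blockSwap_s (hn : 1 ≤ n) (hk : n + 2 ≤ k - 1) :
    SemiconjBy (P.blockSwap n) (P.s (n + 2)) (P.s n) := by
  have hc := (P.commute_s_s_add_two hn hk).eq
  have b1 := P.braid n hn (by omega)
  have b2 : P.s (n + 1) * P.s (n + 2) * P.s (n + 1) = P.s (n + 2) * P.s (n + 1) * P.s (n + 2) :=
    P.braid (n + 1) (by omega) hk
  calc P.blockSwap n * P.s (n + 2)
      = P.s (n + 1) * (P.s n * P.s (n + 2)) * P.s (n + 1) * P.s (n + 2) := by
        rw [hc, blockSwap]; simp only [mul_assoc]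
    _ = P.s (n + 1) * P.s n * (P.s (n + 1) * P.s (n + 2) * P.s (n + 1)) := by
        rw [b2]; simp only [mul_assoc]
    _ = P.s n * P.s (n + 1) * (P.s n * P.s (n + 2)) * P.s (n + 1) := by
        simp only [← mul_assoc]; rw [← b1]
    _ = P.s n * P.blockSwap n := by
        rw [hc, blockSwap]; simp only [mul_assoc]

theorem semiconjBy_blockSwap_q (hn : 1 ≤ n) (hk : n + 2 ≤ k - 1) :
    SemiconjBy (P.blockSwap n) (P.q (n + 2)) (P.q n) :=
  (P.semiconjBy_qskip_q (by omega)).mul_left ((P.semiconjBy_qskip₂_qskip hk).mul_left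
    ((P.semiconjBy_qskip_succ_qskip₂ hn hk).mul_left
      (P.semiconjBy_q_succ_qskip (n := n + 1) (by omega) hk)))

theorem commute_blockSwap_qskip (hn : 1 ≤ n) (hk : n + 2 ≤ k - 1) :
    Commute (P.blockSwap n) (P.qskip n) :=
  (P.semiconjBy_q_qskip (by omega)).mul_left (SemiconjBy.mul_left (P.commute_s_add_two_q hn hk)
    (SemiconjBy.mul_left (P.commute_s_q_self hn (by omega)) (P.semiconjBy_qskip_q (by omega))))

theorem commute_blockSwap_qskip_succ (hn : 1 ≤ n) (hk : n + 2 ≤ k - 1) :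
    Commute (P.blockSwap n) (P.qskip (n + 1)) :=
  (P.semiconjBy_q_succ_qskip (n := n + 1) (by omega) hk).mul_left
    (SemiconjBy.mul_left (P.commute_s_q_self (n := n + 2) (by omega) hk)
    (SemiconjBy.mul_left (P.commute_s_q_add_two hn hk)
      (P.semiconjBy_qskip_q_succ (n := n + 1) (by omega) hk)))

theorem blockSwap_mul_qskip_mul_qskip (hn : 1 ≤ n) (hk : n + 2 ≤ k - 1) :
    P.blockSwap n * (P.qskip n * P.qskip (n + 1)) = P.qskip n * P.qskip (n + 1) := by
  have hs := P.s_sq (n + 1) (by omega) (by omega)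
  have h := ((P.semiconjBy_q_qskip (n := n) (by omega)).mul_right
    (P.semiconjBy_q_succ_qskip (n := n + 1) (by omega) hk)).eq
  have e : P.qskip n * P.qskip (n + 1) = P.s (n + 1) * (P.q n * P.q (n + 2)) * P.s (n + 1) := by
    rw [h, mul_assoc, hs, mul_one]
  calc P.blockSwap n * (P.qskip n * P.qskip (n + 1))
      = P.s (n + 1) * (P.s (n + 2) * ((P.s n * (P.s (n + 1) * P.s (n + 1)) * P.q n)
          * P.q (n + 2))) * P.s (n + 1) := by rw [e, blockSwap]; simp only [mul_assoc]
    _ = P.s (n + 1) * (P.q n * (P.s (n + 2) * P.q (n + 2))) * P.s (n + 1) := by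
        rw [hs, mul_one, P.s_q n hn (by omega), ← mul_assoc (P.s (n + 2)),
          (P.commute_s_add_two_q hn hk).eq, mul_assoc (P.q n)]
    _ = P.qskip n * P.qskip (n + 1) := by rw [P.s_q _ (by omega) hk, e]

end FourPositions

namespace SigHInvariant

variable {P : PartitionAlgebra k A} {n : ℕ}

theorem commute_qskip_succ (h : P.SigHInvariant n) (hn : 1 ≤ n) (hk : n + 2 ≤ k - 1) :
    Commute (P.qskip (n + 1)) (P.sigH n) := by
  have hs : Commute (P.s (n + 2)) (P.sigH n) := by
    obtain ⟨m, rfl⟩ := Nat.exists_eq_add_of_le' hn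
    exact P.commute_s_sigH (by omega) hk
  exact (hs.mul_left (h.commute_q (by omega))).mul_left hs

theorem sigHShift_succ (h : P.SigHInvariant n) (hn : 1 ≤ n) (hk : n + 2 ≤ k - 1) :
    P.sigHShift (n + 1) = P.sigHShift₂ n * flipOp (P.qskip n) (P.qskip₂ n) (P.p n) :=
  SemiconjBy.eq_of_eq (P.s_mul_s_mul_inv (n := n + 1) (by omega) hk)
    (P.semiconjBy_sigH_sigHShift (n := n + 1) (by omega) hk)
    ((P.semiconjBy_sigHShift_sigHShift₂ hk).mul_right
      ((P.semiconjBy_q_qskip_shift hn hk).flipOp (P.semiconjBy_qskip_qskip₂_shift hn hk)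
        (P.semiconjBy_p_shift hn hk)))
    (h.sigH_succ hn (by omega))

theorem succ_q_mul_L_mul_qskip (h : P.SigHInvariant n) (hn : 1 ≤ n) (hk : n + 2 ≤ k - 1) :
    P.q (n + 1) * P.L (n + 1) * P.qskip (n + 1)
      = P.sigHShift (n + 1) * (P.q (n + 1) * P.p (n + 1) * P.qskip (n + 1)) := by
  have hL : P.L (n + 1) = -(P.s n * P.L n * P.q n) - P.q n * P.L n * P.s n
      + P.q n * P.L n * P.p (n + 1) * P.q n + P.s n * P.L n * P.s n + P.s n * P.sigH n := by
    obtain ⟨m, rfl⟩ := Nat.exists_eq_add_of_le' hn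
    rw [P.s_mul_sigH m (by omega)]
    exact P.L_add_two m
  have hLs : Commute (P.s (n + 1) * P.s (n + 2)) (P.L n) := by
    obtain ⟨m, rfl⟩ := Nat.exists_eq_add_of_le' hn
    exact (P.commute_s_L (by omega) (by omega)).mul_left (P.commute_s_L (by omega) (by omega))
  have hτs : Commute (P.s (n + 2)) (P.sigH n) := by
    obtain ⟨m, rfl⟩ := Nat.exists_eq_add_of_le' hn
    exact P.commute_s_sigH (by omega) hk
  have hτq : Commute (P.q (n + 2)) (P.sigH n) := by
    obtain ⟨m, rfl⟩ := Nat.exists_eq_add_of_le' hn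
    exact P.commute_q_sigH (by omega) hk
  have h1 := P.semiconjBy_q_qskip_shift hn hk
  have h2 := P.semiconjBy_qskip_qskip₂_shift hn hk
  have key : P.qskip n * P.L n * P.qskip₂ n
      = P.sigHShift₂ n * (P.qskip n * P.p n * P.qskip₂ n) :=
    SemiconjBy.eq_of_eq (P.s_mul_s_mul_inv (n := n + 1) (by omega) hk)
      ((h1.mul_right hLs).mul_right h2)
      ((P.semiconjBy_sigHShift_sigHShift₂ hk).mul_right
        ((h1.mul_right (P.semiconjBy_p_shift hn hk)).mul_right h2))
      (h.q_mul_L_mul_qskip (by omega))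
  have hW := P.blockSwap_mul_qskip_mul_qskip hn hk
  have hτ : P.sigH n * (P.qskip n * P.qskip (n + 1))
      = P.sigHShift₂ n * (P.qskip n * P.qskip (n + 1)) := by
    have hc : Commute (P.qskip n * P.qskip (n + 1)) (P.sigH n) :=
      (h.commute_qskip hn (by omega)).mul_left (h.commute_qskip_succ hn hk)
    have hc' : Commute (P.qskip n * P.qskip (n + 1)) (P.blockSwap n) :=
      ((P.commute_blockSwap_qskip hn hk).mul_right (P.commute_blockSwap_qskip_succ hn hk)).symm
    calc P.sigH n * (P.qskip n * P.qskip (n + 1))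
        = P.blockSwap n * (P.qskip n * P.qskip (n + 1)) * P.sigH n := by rw [hW, hc.eq]
      _ = P.blockSwap n * P.sigH n * (P.qskip n * P.qskip (n + 1)) := by
          rw [mul_assoc, hc.eq, mul_assoc]
      _ = P.sigHShift₂ n * (P.qskip n * P.qskip (n + 1)) := by
          rw [(P.semiconjBy_sigH_sigHShift₂ hn hk).eq, mul_assoc, hW]
  rw [hL, h.sigHShift_succ hn hk]
  exact key_step (P.s_sq n hn (by omega)) (P.s_q n hn (by omega)) (P.q_s n hn (by omega))
    (P.semiconjBy_qskip_q_succ hn (by omega)).eq (P.semiconjBy_qskip₂_qskip_succ hn hk).eq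
    (P.semiconjBy_p_p_succ hn (by omega)).eq (P.q_mul_qskip hn (by omega))
    (P.qskip_mul_q_succ hn (by omega)) (P.commute_q_q_succ hn (by omega)).eq.symm
    (P.qskip₂_mul_q hn hk) (P.qskip₂_mul_qskip_succ hn hk) (P.commute_q_succ_qskip₂ hn hk).eq
    (P.commute_p_succ_qskip₂ hn hk).eq (P.commute_q_succ_p hn (by omega)).eq.symm
    (P.p_mul_q_mul_p_succ hn (by omega)) (P.qskip₂_mul_p_mul_qskip₂ hn hk)
    (P.commute_sigHShift₂ hn hk (P.semiconjBy_blockSwap_s hn hk) hτs).eq.symm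
    (P.commute_sigHShift₂ hn hk (P.semiconjBy_blockSwap_q hn hk) hτq).eq.symm
    hτ (h.commute_qskip hn (by omega)).eq.symm key

theorem succ (h : P.SigHInvariant n) (hn : 1 ≤ n) (hk : n + 1 ≤ k - 1) :
    P.SigHInvariant (n + 1) where
  commute_s := by
    have hf : Commute (P.s (n + 1)) (flipOp (P.q n) (P.qskip n) (P.p n)) := by
      have := (P.semiconjBy_q_qskip hk).flipOp (P.semiconjBy_qskip_q hk)
        (P.commute_s_succ_p hn hk)
      rwa [flipOp_symm (P.qskip n)] at this
    rw [h.sigH_succ hn hk]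
    exact (h.commute_s_sigHShift hn hk).mul_right hf
  commute_q hk' := by
    have hs : Commute (P.q (n + 2)) (P.s n) := (P.commute_s_q_add_two hn hk').symm
    have hq : Commute (P.q (n + 2)) (P.qskip n) := by
      have e : P.qskip n = P.s n * P.q (n + 1) * P.s n := by
        rw [(P.semiconjBy_q_succ_qskip hn hk).eq, mul_assoc, P.s_sq n hn (by omega), mul_one]
      rw [e]
      exact (hs.mul_right (P.commute_q_q_succ (n := n + 1) (by omega) hk').symm).mul_right hs
    have hf : Commute (P.q (n + 2)) (flipOp (P.q n) (P.qskip n) (P.p n)) :=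
      SemiconjBy.flipOp (P.q_comm _ _ (by omega) hk' hn (by omega)) hq
        (P.q_p _ _ (by omega) hk' hn (by omega) (by omega) (by omega))
    rw [h.sigH_succ hn hk]
    refine Commute.mul_right ?_ hf
    exact P.commute_sigHShift hn hk (SemiconjBy.mul_left hs.symm
      (P.semiconjBy_qskip_q_succ (n := n + 1) (by omega) hk')) (h.commute_qskip_succ hn hk')
  q_mul_L_mul_qskip hk' := h.succ_q_mul_L_mul_qskip hn hk'

end SigHInvariant

theorem sigHInvariant (P : PartitionAlgebra k A) {n : ℕ} (hn : 1 ≤ n) (hk : n ≤ k - 1) :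
    P.SigHInvariant n := by
  induction n, hn using Nat.le_induction with
  | base =>
    refine ⟨?_, fun _ => ?_, fun h => ?_⟩
    · rw [sigH_one]; exact Commute.one_right _
    · rw [sigH_one]; exact Commute.one_right _
    · have e : P.sigHShift 1 = 1 := by
        rw [sigHShift, sigH_one, mul_one, P.s_sq _ (by omega) h, mul_one,
          P.s_sq 1 le_rfl (by omega)]
      rw [e, L_one, one_mul]
  | succ n hn ih => exact (ih (by omega)).succ hn hk

theorem sigH_mul_self (P : PartitionAlgebra k A) {n : ℕ} (hn : 1 ≤ n) (hk : n ≤ k - 1) :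
    P.sigH n * P.sigH n = 1 := by
  induction n, hn using Nat.le_induction with
  | base => rw [sigH_one, mul_one]
  | succ n hn ih =>
    have h := P.sigHInvariant hn (by omega)
    have hu := P.semiconjBy_sigH_sigHShift hn hk
    have hu2 : P.sigHShift n * P.sigHShift n = 1 :=
      SemiconjBy.eq_of_eq (P.s_mul_s_mul_inv hn hk) (hu.mul_right hu)
        (SemiconjBy.one_right _) (ih (by omega))
    rw [h.sigH_succ hn hk, (h.commute_flipOp_sigHShift hn hk).symm.mul_mul_mul_comm, hu2,
      P.flipOp_q_qskip_mul_self hn hk, mul_one]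

end PartitionAlgebra

/-- Proposition 4.2: `σ_{i+1/2}` and `σ_{i+1}` are involutions for `1 ≤ i ≤ k-1`. -/
theorem partitionAlgebra_sig_involution {k : ℕ} {A : Type*} [Ring A]
    [Algebra (Polynomial ℤ) A] (P : PartitionAlgebra k A) :
    ∀ i, 1 ≤ i → i ≤ k - 1 →
      P.sigH i * P.sigH i = 1 ∧ P.sig (i + 1) * P.sig (i + 1) = 1 := by
  intro i hi hk
  have hH := P.sigH_mul_self hi hk
  refine ⟨hH, ?_⟩
  have hc := (P.sigHInvariant hi hk).commute_s
  have e : P.sig (i + 1) = P.s i * P.sigH i := by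
    obtain ⟨m, rfl⟩ := Nat.exists_eq_add_of_le' hi
    exact (P.s_mul_sigH m hk).symm
  rw [e, hc.symm.mul_mul_mul_comm, P.s_sq i hi hk, hH, mul_one]
end
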